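/- arXiv:2102.12543 — 6 statements merged into one kernel-verified Lean document; each statement's English description precedes it below -/
import Mathlib

section
/- Theorem 1(i): For all positive integers n and n' with n' ≥ 2 and d = n' − 1, the signaling polytope equals the maximum likelihood polytope: C_{n'−1}^{n→n'} = M_{n'−1}^{n→n'}. -/
open Finset

/-- A classical channel: an `n' × n` column-stochastic real matrix. -/
def IsChannel {n n' : ℕ} (P : Matrix (Fin n') (Fin n) ℝ) : Prop :=
  (∀ y x, 0 ≤ P y x) ∧ ∀ x, ∑ y, P y x = 1

/-- A vertex of the signaling polytope: a column-stochastic 0/1 matrix with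
at most `d` nonzero rows. -/
def IsVertex {n n' : ℕ} (d : ℕ) (V : Matrix (Fin n') (Fin n) ℝ) : Prop :=
  IsChannel V ∧ (∀ y x, V y x = 0 ∨ V y x = 1) ∧
    ({y : Fin n' | ∃ x, V y x ≠ 0}).ncard ≤ d

/-- The signaling polytope `C_d^{n → n'}`. -/
def signalingPolytope (n n' d : ℕ) : Set (Matrix (Fin n') (Fin n) ℝ) :=
  convexHull ℝ {V | IsVertex d V}

/-- The Euclidean inner product `⟨G, P⟩ = ∑_{x,y} G_{y,x} P(y|x)`. -/
def bip {n n' : ℕ} (G P : Matrix (Fin n') (Fin n) ℝ) : ℝ :=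
  ∑ x, ∑ y, G y x * P y x

/-- Maximum likelihood score: `∑_y max_x P(y|x)`. -/
noncomputable def mlScore {n n' : ℕ} (P : Matrix (Fin n') (Fin n) ℝ) : ℝ :=
  ∑ y, ⨆ x, P y x

/-- The maximum likelihood polytope `M_d^{n → n'}`. -/
def mlPolytope (n n' d : ℕ) : Set (Matrix (Fin n') (Fin n) ℝ) :=
  {P | IsChannel P ∧ mlScore P ≤ (d : ℝ)}

/-- Two probability vectors with `p i + q i ≤ 1` for every `i` admit a coupling that vanishes
on the diagonal. -/
theorem exists_coupling_diag_eq_zero {ι : Type*} [Fintype ι] [DecidableEq ι] {p q : ι → ℝ}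
    (hp : p ∈ stdSimplex ℝ ι) (hq : q ∈ stdSimplex ℝ ι) (hpq : ∀ i, p i + q i ≤ 1) :
    ∃ T : ι → ι → ℝ, (∀ i j, 0 ≤ T i j) ∧ (∀ i, ∑ j, T i j = q i) ∧
      (∀ j, ∑ i, T i j = p j) ∧ ∀ i, T i i = 0 := by
  let K : Set (ι → ι → ℝ) :=
    {T | (∀ i j, 0 ≤ T i j) ∧ (∀ i, ∑ j, T i j = q i) ∧ ∀ j, ∑ i, T i j = p j}
  have hK : IsCompact K := by
    refine (isCompact_Icc (a := (0 : ι → ι → ℝ)) (b := fun i _ => q i)).of_isClosed_subset ?_ ?_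
    · simp only [K, Set.ofPred_and, Set.ofPred_forall]
      refine .inter ?_ (.inter ?_ ?_)
      · exact isClosed_iInter fun i => isClosed_iInter fun j =>
          isClosed_le (by fun_prop) (by fun_prop)
      · exact isClosed_iInter fun i => isClosed_eq (by fun_prop) (by fun_prop)
      · exact isClosed_iInter fun j => isClosed_eq (by fun_prop) (by fun_prop)
    · rintro T ⟨h0, hrow, -⟩
      refine ⟨fun i j => h0 i j, fun i j => ?_⟩
      exact (single_le_sum (f := T i) (fun j _ => h0 i j) (mem_univ j)).trans_eq (hrow i)
  have hne : K.Nonempty := by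
    refine ⟨fun i j => q i * p j, fun i j => mul_nonneg (hq.1 i) (hp.1 j), fun i => ?_, fun j => ?_⟩
    · rw [← mul_sum, hp.2, mul_one]
    · rw [← sum_mul, hq.2, one_mul]
  obtain ⟨T, ⟨h0, hrow, hcol⟩, hmin⟩ := hK.exists_isMinOn hne
    (f := fun T => ∑ i, T i i) (by fun_prop)
  refine ⟨T, h0, hrow, hcol, fun y => ?_⟩
  by_contra hy
  have hTy : 0 < T y y := lt_of_le_of_ne (h0 y y) (Ne.symm hy)
  obtain ⟨a, b, ha, hb, hab⟩ : ∃ a b, a ≠ y ∧ b ≠ y ∧ 0 < T a b := by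
    by_contra! H
    have hqi : ∀ i ∈ univ.erase y, q i = T i y := fun i hi => by
      rw [← hrow i]
      exact sum_eq_single y
        (fun j _ hj => le_antisymm (H i j (ne_of_mem_erase hi) hj) (h0 i j)) (by simp)
    have h1 := add_sum_erase univ q (mem_univ y)
    have h2 := add_sum_erase univ (fun i => T i y) (mem_univ y)
    rw [sum_congr rfl hqi, hq.2] at h1
    rw [hcol y] at h2
    linarith [hpq y]
  -- Moving mass from `(y, y)` and `(a, b)` to `(a, y)` and `(y, b)` lowers the diagonal sum.
  let ε := min (T y y) (T a b)
  have hε : 0 < ε := lt_min hTy hab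
  let δ : ι → ι → ℝ := fun i j => if i = j then 1 else 0
  let T' : ι → ι → ℝ := fun i j => T i j + ε * ((δ a i - δ y i) * (δ y j - δ b j))
  have hδ : ∀ i, ∑ j, δ i j = 1 := fun i => by simp [δ]
  have hT' : T' ∈ K := by
    refine ⟨fun i j => ?_, fun i => ?_, fun j => ?_⟩
    · have e1 : ε ≤ T y y := min_le_left _ _
      have e2 : ε ≤ T a b := min_le_right _ _
      have e3 := h0 i j
      simp only [T', δ]
      split_ifs <;> subst_vars <;> first | contradiction | nlinarith
    · simp only [T', sum_add_distrib, ← mul_sum, sum_sub_distrib, hδ, hrow]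
      ring
    · simp only [T', sum_add_distrib, ← mul_sum, ← sum_mul, sum_sub_distrib, hδ, hcol]
      ring
  have hlt : ∑ i, T' i i < ∑ i, T i i := by
    refine sum_lt_sum (fun i _ => ?_) ⟨y, mem_univ y, ?_⟩
    · simp only [T', δ]
      split_ifs <;> subst_vars <;> first | contradiction | nlinarith
    · simp [T', δ, ha, hb, hε]
  exact absurd (hmin hT') (not_le.2 hlt)

/-- A channel that never outputs `y` is a mixture of deterministic channels never outputting `y`. -/
theorem IsChannel.mem_signalingPolytope_of_row_eq_zero {n n' : ℕ}
    {P : Matrix (Fin n') (Fin n) ℝ} (hP : IsChannel P) (y : Fin n') (hy : ∀ x, P y x = 0) :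
    P ∈ signalingPolytope n n' (n' - 1) := by
  let s : Set (Fin n' → ℝ) := {v | ∃ z ≠ y, v = Pi.single z 1}
  have hcol : (fun x z => P z x) ∈ convexHull ℝ (Set.univ.pi fun _ : Fin n => s) := by
    rw [convexHull_pi]
    intro x _
    have hsum : ∑ z ∈ univ.erase y, P z x = 1 :=
      (sum_erase (f := fun z => P z x) univ (hy x)).trans (hP.2 x)
    have h := (convex_convexHull ℝ s).sum_mem (t := univ.erase y) (w := fun z => P z x)
      (z := fun z => Pi.single z (1 : ℝ)) (fun z _ => hP.1 z x) hsum
      fun z hz => subset_convexHull ℝ s ⟨z, ne_of_mem_erase hz, rfl⟩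
    rw [sum_erase _ (by simp [hy x])] at h
    convert h using 1
    ext z
    simp [Finset.sum_apply, Pi.single_apply]
  let L : (Fin n → Fin n' → ℝ) →ₗ[ℝ] Matrix (Fin n') (Fin n) ℝ :=
    { toFun := fun f => Matrix.of fun z x => f x z
      map_add' := fun _ _ => rfl
      map_smul' := fun _ _ => rfl }
  have hL : P ∈ L '' convexHull ℝ (Set.univ.pi fun _ : Fin n => s) := ⟨_, hcol, rfl⟩
  rw [L.image_convexHull] at hL
  refine convexHull_mono ?_ hL
  rintro _ ⟨f, hf, rfl⟩
  choose g hg hfg using fun x => hf x (Set.mem_univ x)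
  have hV : ∀ z x, L f z x = if z = g x then 1 else 0 := fun z x => by
    change f x z = _
    rw [hfg, Pi.single_apply]
  refine ⟨⟨fun z x => ?_, fun x => ?_⟩, fun z x => ?_, ?_⟩
  · rw [hV]; split_ifs <;> norm_num
  · simp [hV]
  · rw [hV]; split_ifs <;> simp
  · have hsub : {z : Fin n' | ∃ x, L f z x ≠ 0} ⊆ ((univ.erase y : Finset (Fin n')) : Set _) := by
      rintro z ⟨x, hx⟩
      rw [hV] at hx
      have : z = g x := by by_contra h; simp [h] at hx
      simpa [this] using hg x
    refine (Set.ncard_le_ncard hsub (Finset.finite_toSet _)).trans ?_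
    rw [Set.ncard_coe_finset, card_erase_of_mem (mem_univ y), card_univ, Fintype.card_fin]

theorem le_iSup_row {n n' : ℕ} (P : Matrix (Fin n') (Fin n) ℝ) (y : Fin n') (x : Fin n) :
    P y x ≤ ⨆ x, P y x :=
  le_ciSup (f := fun x => P y x) (Set.finite_range _).bddAbove x

theorem IsVertex.mlScore_le {n n' d : ℕ} {V : Matrix (Fin n') (Fin n) ℝ} (hV : IsVertex d V) :
    mlScore V ≤ d := by
  classical
  have hle : ∀ y, ⨆ x, V y x ≤ if ∃ x, V y x ≠ 0 then (1 : ℝ) else 0 := fun y => by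
    refine Real.iSup_le (fun x => ?_) (by split_ifs <;> norm_num)
    rcases hV.2.1 y x with h | h
    · rw [h]; split_ifs <;> norm_num
    · rw [if_pos ⟨x, by simp [h]⟩, h]
  refine (sum_le_sum fun y _ => hle y).trans ?_
  have hcard := hV.2.2
  rw [Set.ncard_eq_toFinset_card', Set.toFinset_ofPred] at hcard
  rw [sum_boole]
  exact_mod_cast hcard

theorem convex_mlPolytope {n : ℕ} (hn : 0 < n) (n' d : ℕ) : Convex ℝ (mlPolytope n n' d) := by
  have : Nonempty (Fin n) := ⟨⟨0, hn⟩⟩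
  rintro P ⟨hP, hPd⟩ Q ⟨hQ, hQd⟩ a b ha hb hab
  refine ⟨⟨fun y x => ?_, fun x => ?_⟩, ?_⟩
  · exact add_nonneg (mul_nonneg ha (hP.1 y x)) (mul_nonneg hb (hQ.1 y x))
  · simp [sum_add_distrib, ← mul_sum, hP.2, hQ.2, hab]
  · calc mlScore (a • P + b • Q) ≤ ∑ y, (a * (⨆ x, P y x) + b * ⨆ x, Q y x) :=
          sum_le_sum fun y _ => ciSup_le fun x =>
            add_le_add (mul_le_mul_of_nonneg_left (le_iSup_row P y x) ha)
              (mul_le_mul_of_nonneg_left (le_iSup_row Q y x) hb)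
      _ = a * mlScore P + b * mlScore Q := by
          simp only [mlScore, sum_add_distrib, ← mul_sum]
      _ ≤ a * d + b * d := by gcongr
      _ = d := by rw [← add_mul, hab, one_mul]

theorem signalingPolytope_subset_mlPolytope {n : ℕ} (hn : 0 < n) (n' d : ℕ) :
    signalingPolytope n n' d ⊆ mlPolytope n n' d :=
  convexHull_min (fun _ hV => ⟨hV.1, hV.mlScore_le⟩) (convex_mlPolytope hn n' d)

/-- A channel is a mixture, with weights `q`, of channels missing a row as soon as each row `y`
is bounded by `1 - q y`. -/
theorem IsChannel.mem_signalingPolytope_of_le_one_sub {n n' : ℕ}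
    {P : Matrix (Fin n') (Fin n) ℝ} (hP : IsChannel P) {q : Fin n' → ℝ}
    (hq : q ∈ stdSimplex ℝ (Fin n')) (hPq : ∀ y x, P y x + q y ≤ 1) :
    P ∈ signalingPolytope n n' (n' - 1) := by
  choose T h0 hrow hcol hdiag using fun x =>
    exists_coupling_diag_eq_zero (p := fun y => P y x) ⟨fun y => hP.1 y x, hP.2 x⟩ hq
      fun y => hPq y x
  have hR : ∀ y ∈ univ.filter (q · ≠ 0), (Matrix.of fun z x => T x y z / q y) ∈
      signalingPolytope n n' (n' - 1) := fun y hy => by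
    have hqy : q y ≠ 0 := (mem_filter.1 hy).2
    refine IsChannel.mem_signalingPolytope_of_row_eq_zero
      ⟨fun z x => div_nonneg (h0 x y z) (hq.1 y), fun x => ?_⟩ y fun x => ?_
    · simp only [Matrix.of_apply]
      rw [← sum_div, hrow, div_self hqy]
    · simp [hdiag]
  have h := (convex_convexHull ℝ {V | IsVertex (n' - 1) V}).sum_mem
    (fun y _ => hq.1 y) ((sum_filter_ne_zero univ).trans hq.2) hR
  have hPsum : P = ∑ y ∈ univ.filter (q · ≠ 0), q y • Matrix.of fun z x => T x y z / q y := by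
    ext z x
    rw [Matrix.sum_apply, ← hcol x z, sum_filter]
    refine sum_congr rfl fun y _ => ?_
    split_ifs with hqy
    · simp [mul_div_cancel₀ _ hqy]
    · have hle := single_le_sum (f := T x y) (fun z _ => h0 x y z) (mem_univ z)
      rw [hrow, not_not.1 hqy] at hle
      exact le_antisymm hle (h0 x y z)
  rw [hPsum]
  exact h

/-- Theorem 1(i): for `d = n' - 1`, the signaling polytope equals the ML polytope. -/
theorem signalingPolytope_eq_mlPolytope (n n' : ℕ) (hn : 0 < n) (hn' : 2 ≤ n') :
    signalingPolytope n n' (n' - 1) = mlPolytope n n' (n' - 1) := by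
  have : Nonempty (Fin n) := ⟨⟨0, hn⟩⟩
  refine (signalingPolytope_subset_mlPolytope hn n' (n' - 1)).antisymm ?_
  rintro P ⟨hP, hPd⟩
  have hle_one : ∀ y, ⨆ x, P y x ≤ 1 := fun y => ciSup_le fun x => by
    rw [← hP.2 x]
    exact single_le_sum (f := fun y => P y x) (fun y _ => hP.1 y x) (mem_univ y)
  set S := ∑ y, (1 - ⨆ x, P y x) with hSdef
  have hS : 1 ≤ S := by
    have hsum : S = n' - mlScore P := by simp [hSdef, mlScore]
    rw [Nat.cast_sub (by omega), Nat.cast_one] at hPd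
    linarith
  refine hP.mem_signalingPolytope_of_le_one_sub (q := fun y => (1 - ⨆ x, P y x) / S)
    ⟨fun y => div_nonneg (sub_nonneg.2 (hle_one y)) (by linarith), ?_⟩ fun y x => ?_
  · rw [← sum_div, ← hSdef, div_self (by linarith)]
  · linarith [le_iSup_row P y x, div_le_self (sub_nonneg.2 (hle_one y)) hS]
end

section
/- Theorem 1(ii): For all positive integers n and n' with n' ≥ n ≥ 2 and d = n − 1, the signaling polytope equals the intersection of ambiguous polytopes: C_{n−1}^{n→n'} = ⋂_{k=n}^{n'} A_{k,n−1}^{n→n'}. -/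
open Finset

/-- An ambiguous guessing game matrix `G^{n,n'}_{k,d}`: `k` guessing rows (0/1 rows
with exactly one entry equal to 1) and `n' - k` ambiguous rows (all entries
`1/(n-d+1)`). -/
def IsAmbiguousGame (n n' k d : ℕ) (G : Matrix (Fin n') (Fin n) ℝ) : Prop :=
  ∃ S : Finset (Fin n'), S.card = k ∧
    (∀ y ∈ S, ∃ x₀, G y x₀ = 1 ∧ ∀ x, x ≠ x₀ → G y x = 0) ∧
    ∀ y ∉ S, ∀ x, G y x = 1 / ((n : ℝ) - (d : ℝ) + 1)

/-- The `(k,d)`-ambiguous polytope `A_{k,d}^{n → n'}`. -/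
def ambiguousPolytope (n n' k d : ℕ) : Set (Matrix (Fin n') (Fin n) ℝ) :=
  {P | IsChannel P ∧ ∀ G, IsAmbiguousGame n n' k d G → bip G P ≤ (d : ℝ)}

/-- The number of endpoints of the pair `e` that are equal to `z`. -/
def pairIncidence {ι : Type*} [DecidableEq ι] (e : {p : ι × ι // p.1 ≠ p.2}) (z : ι) : ℝ :=
  (if z = e.1.1 then 1 else 0) + (if z = e.1.2 then 1 else 0)

lemma pairIncidence_nonneg {ι : Type*} [DecidableEq ι] (e : {p : ι × ι // p.1 ≠ p.2}) (z : ι) :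
    0 ≤ pairIncidence e z := by
  unfold pairIncidence; positivity

lemma sum_pairIncidence {ι : Type*} [Fintype ι] [DecidableEq ι]
    (e : {p : ι × ι // p.1 ≠ p.2}) : ∑ z, pairIncidence e z = 2 := by
  simp only [pairIncidence, sum_add_distrib, sum_ite_eq', mem_univ, if_true]
  norm_num

/-- A maximum fractional matching of the complete graph on `ι` with vertex capacities `c`. -/
lemma exists_max_fractional_matching {ι : Type*} [Fintype ι] [DecidableEq ι] (c : ι → ℝ)
    (hc : ∀ x, 0 ≤ c x) :
    ∃ w : {p : ι × ι // p.1 ≠ p.2} → ℝ, ((∀ e, 0 ≤ w e) ∧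
      ∀ z, ∑ e, w e * pairIncidence e z ≤ c z) ∧
      ∀ v : {p : ι × ι // p.1 ≠ p.2} → ℝ, (∀ e, 0 ≤ v e) →
        (∀ z, ∑ e, v e * pairIncidence e z ≤ c z) → ∑ e, v e ≤ ∑ e, w e := by
  let K : Set ({p : ι × ι // p.1 ≠ p.2} → ℝ) :=
    {w | (∀ e, 0 ≤ w e) ∧ ∀ z, ∑ e, w e * pairIncidence e z ≤ c z}
  have hclosed : IsClosed K := by
    refine IsClosed.and ?_ ?_
    · simp only [Set.ofPred_forall]
      exact isClosed_iInter fun e => isClosed_le (by fun_prop) (by fun_prop)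
    · simp only [Set.ofPred_forall]
      exact isClosed_iInter fun e => isClosed_le (by fun_prop) (by fun_prop)
  have hsub : K ⊆ Set.Icc 0 (fun e => c e.1.1) := by
    rintro w ⟨h0, h1⟩
    refine ⟨fun e => h0 e, fun e => ?_⟩
    refine le_trans ?_ (h1 e.1.1)
    have := single_le_sum (f := fun e' => w e' * pairIncidence e' e.1.1)
      (fun e' _ => mul_nonneg (h0 e') (pairIncidence_nonneg _ _)) (mem_univ e)
    simpa [pairIncidence, e.2] using this
  have hK : IsCompact K := isCompact_Icc.of_isClosed_subset hclosed hsub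
  obtain ⟨w, hw, hmax⟩ := hK.exists_isMaxOn ⟨0, by simpa [K] using hc⟩
    (f := fun w => ∑ e, w e) (by fun_prop)
  exact ⟨w, hw, fun v h0 h1 => hmax (a := v) ⟨h0, h1⟩⟩

/-- The complete graph on `ι` with vertex capacities `c` has a fractional matching whose weight
is at least half the total capacity or the total capacity minus that of one vertex. -/
lemma exists_large_fractional_matching {ι : Type*} [Fintype ι] [DecidableEq ι] (c : ι → ℝ)
    (hc : ∀ x, 0 ≤ c x) :
    ∃ w : {p : ι × ι // p.1 ≠ p.2} → ℝ, (∀ e, 0 ≤ w e) ∧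
      (∀ z, ∑ e, w e * pairIncidence e z ≤ c z) ∧
      ((∑ x, c x) / 2 ≤ ∑ e, w e ∨ ∃ x, ∑ x, c x - c x ≤ ∑ e, w e) := by
  obtain ⟨w, ⟨h0, h1⟩, hmax⟩ := exists_max_fractional_matching c hc
  refine ⟨w, h0, h1, ?_⟩
  have hdouble : ∑ z, ∑ e, w e * pairIncidence e z = 2 * ∑ e, w e := by
    rw [sum_comm, mul_sum]
    refine sum_congr rfl fun e _ => ?_
    rw [← mul_sum, sum_pairIncidence, mul_comm]
  by_cases hsat : ∀ z, c z ≤ ∑ e, w e * pairIncidence e z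
  · left
    have := sum_le_sum fun z (_ : z ∈ univ) => hsat z
    linarith
  right
  push Not at hsat
  obtain ⟨x, hx⟩ := hsat
  refine ⟨x, ?_⟩
  have hother : ∀ y, y ≠ x → c y ≤ ∑ e, w e * pairIncidence e y := by
    intro y hy
    by_contra! hlt
    let f : {p : ι × ι // p.1 ≠ p.2} := ⟨(x, y), hy.symm⟩
    obtain ⟨ε, hε, hεx, hεy⟩ : ∃ ε : ℝ, 0 < ε ∧
        ε ≤ c x - ∑ e, w e * pairIncidence e x ∧ ε ≤ c y - ∑ e, w e * pairIncidence e y :=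
      ⟨_, lt_min (sub_pos.2 hx) (sub_pos.2 hlt), min_le_left _ _, min_le_right _ _⟩
    have := hmax (fun e => w e + if e = f then ε else 0)
      (fun e => add_nonneg (h0 e) (by split_ifs <;> linarith)) (fun z => by
        simp only [add_mul, sum_add_distrib, ite_mul, zero_mul, sum_ite_eq', mem_univ, if_true]
        have hz := h1 z
        by_cases hzx : z = x
        · subst hzx
          simp only [pairIncidence, f, if_true, if_neg hy.symm] at *
          linarith
        · by_cases hzy : z = y
          · subst hzy
            simp only [pairIncidence, f, if_true, if_neg hy] at *
            linarith
          · simp only [pairIncidence, f, if_neg hzx, if_neg hzy] at *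
            linarith)
    simp only [sum_add_distrib, sum_ite_eq', mem_univ, if_true] at this
    linarith
  have hstar : ∀ e : {p : ι × ι // p.1 ≠ p.2}, x ≠ e.1.1 → x ≠ e.1.2 → w e = 0 := by
    rintro e hu hv
    by_contra hne
    have hpos : 0 < w e := lt_of_le_of_ne (h0 e) (Ne.symm hne)
    let f : {p : ι × ι // p.1 ≠ p.2} := ⟨(x, e.1.1), hu⟩
    let g : {p : ι × ι // p.1 ≠ p.2} := ⟨(x, e.1.2), hv⟩
    obtain ⟨ε, hε, hεx, hεe⟩ : ∃ ε : ℝ, 0 < ε ∧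
        ε ≤ (c x - ∑ e, w e * pairIncidence e x) / 2 ∧ ε ≤ w e :=
      ⟨_, lt_min (half_pos (sub_pos.2 hx)) hpos, min_le_left _ _, min_le_right _ _⟩
    have := hmax (fun e' => w e' - (if e' = e then ε else 0) + (if e' = f then ε else 0)
        + (if e' = g then ε else 0))
      (fun e' => by
        have h0' := h0 e'
        have hf : 0 ≤ if e' = f then ε else 0 := by split_ifs <;> linarith
        have hg : 0 ≤ if e' = g then ε else 0 := by split_ifs <;> linarith
        by_cases hee : e' = e
        · rw [if_pos hee]
          rw [hee] at hf hg ⊢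
          linarith
        · rw [if_neg hee]
          linarith)
      (fun z => by
        simp only [add_mul, sub_mul, sum_add_distrib, sum_sub_distrib, ite_mul, zero_mul,
          sum_ite_eq', mem_univ, if_true]
        have hz := h1 z
        have hinc : pairIncidence f z + pairIncidence g z - pairIncidence e z =
            2 * if z = x then 1 else 0 := by
          simp only [pairIncidence, f, g]
          ring
        have hcalc : ∑ e, w e * pairIncidence e z + ε * (2 * if z = x then 1 else 0) ≤ c z := by
          by_cases hzx : z = x
          · subst hzx
            simp only [if_true]
            linarith
          · simpa [if_neg hzx] using hz
        rw [← hinc] at hcalc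
        linarith)
    simp only [sum_add_distrib, sum_sub_distrib, sum_ite_eq', mem_univ, if_true] at this
    linarith
  have hx' : ∑ e, w e * pairIncidence e x = ∑ e, w e := by
    refine sum_congr rfl fun e _ => ?_
    have hne := e.2
    by_cases hu : x = e.1.1
    · have hv : x ≠ e.1.2 := fun h => hne (hu.symm.trans h)
      simp [pairIncidence, if_pos hu, if_neg hv]
    · by_cases hv : x = e.1.2
      · simp [pairIncidence, if_neg hu, if_pos hv]
      · simp [hstar e hu hv]
  have hsum : ∑ y ∈ univ.erase x, c y ≤
      ∑ y ∈ univ.erase x, ∑ e, w e * pairIncidence e y :=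
    sum_le_sum fun y hy => hother y (ne_of_mem_erase hy)
  have e1 := add_sum_erase univ c (mem_univ x)
  have e2 := add_sum_erase univ (fun z => ∑ e, w e * pairIncidence e z) (mem_univ x)
  linarith

lemma IsChannel.sum_sum_eq {n n' : ℕ} {P : Matrix (Fin n') (Fin n) ℝ} (hP : IsChannel P) :
    ∑ y, ∑ x, P y x = n :=
  sum_comm.trans (by simp [hP.2])

lemma convex_isChannel {n n' : ℕ} :
    Convex ℝ {P : Matrix (Fin n') (Fin n) ℝ | IsChannel P} := by
  rintro P ⟨hP0, hP1⟩ Q ⟨hQ0, hQ1⟩ a b ha hb hab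
  refine ⟨fun y x => ?_, fun x => ?_⟩
  · simpa using add_nonneg (mul_nonneg ha (hP0 y x)) (mul_nonneg hb (hQ0 y x))
  · simp [sum_add_distrib, ← mul_sum, hP1, hQ1, hab]

lemma convex_ambiguousPolytope (n n' k d : ℕ) : Convex ℝ (ambiguousPolytope n n' k d) := by
  rintro P ⟨hP, hP'⟩ Q ⟨hQ, hQ'⟩ a b ha hb hab
  refine ⟨convex_isChannel hP hQ ha hb hab, fun G hG => ?_⟩
  have hlin : bip G (a • P + b • Q) = a * bip G P + b * bip G Q := by
    simp only [bip, mul_sum, ← sum_add_distrib]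
    refine sum_congr rfl fun x _ => sum_congr rfl fun y _ => ?_
    simp only [Matrix.add_apply, Matrix.smul_apply, smul_eq_mul]
    ring
  rw [hlin]
  calc a * bip G P + b * bip G Q ≤ a * d + b * d :=
        add_le_add (mul_le_mul_of_nonneg_left (hP' G hG) ha)
          (mul_le_mul_of_nonneg_left (hQ' G hG) hb)
    _ = d := by rw [← add_mul, hab, one_mul]

lemma IsVertex.exists_eq_ite {n n' d : ℕ} {V : Matrix (Fin n') (Fin n) ℝ} (hV : IsVertex d V) :
    ∃ f : Fin n → Fin n', ∀ y x, V y x = if y = f x then 1 else 0 := by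
  obtain ⟨⟨h0, h1⟩, h01, -⟩ := hV
  have hex : ∀ x, ∃ y, V y x = 1 := by
    intro x
    by_contra! h
    have hz : ∀ y, V y x = 0 := fun y => (h01 y x).resolve_right (h y)
    simpa [hz] using h1 x
  choose f hf using hex
  refine ⟨f, fun y x => ?_⟩
  split_ifs with h
  · rw [h, hf]
  · have hs := sum_le_sum_of_subset_of_nonneg (f := fun y => V y x) (subset_univ {y, f x})
      fun i _ _ => h0 i x
    rw [sum_pair h, h1, hf] at hs
    linarith [h0 y x]

lemma IsVertex.mem_ambiguousPolytope {n n' k : ℕ} (hn : 2 ≤ n)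
    {V : Matrix (Fin n') (Fin n) ℝ} (hV : IsVertex (n - 1) V) :
    V ∈ ambiguousPolytope n n' k (n - 1) := by
  refine ⟨hV.1, ?_⟩
  rintro G ⟨S, -, hS, hS'⟩
  obtain ⟨f, hf⟩ := hV.exists_eq_ite
  have hcast : ((n - 1 : ℕ) : ℝ) = n - 1 := by
    rw [Nat.cast_sub (by omega), Nat.cast_one]
  have hamb : ∀ y ∉ S, ∀ x, G y x = 1 / 2 := by
    intro y hy x
    rw [hS' y hy x, hcast]
    norm_num
  have hnotinj : ¬ Function.Injective f := by
    intro hinj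
    have hrange : {y : Fin n' | ∃ x, V y x ≠ 0} = Set.range f := by
      ext y
      simp only [hf, Set.mem_ofPred_eq, Set.mem_range]
      exact exists_congr fun x => by simp [eq_comm]
    have hcard := hV.2.2
    rw [hrange, ← Set.image_univ, Set.ncard_image_of_injective _ hinj, Set.ncard_univ,
      Nat.card_fin] at hcard
    omega
  obtain ⟨a, b, hab, hne⟩ : ∃ a b, f a = f b ∧ a ≠ b := by
    simpa [Function.Injective] using hnotinj
  have hle : ∀ y x, G y x ≤ 1 := by
    intro y x
    by_cases hy : y ∈ S
    · obtain ⟨x₀, hx₀, hx⟩ := hS y hy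
      by_cases h : x = x₀
      · rw [h, hx₀]
      · rw [hx x h]; norm_num
    · rw [hamb y hy]; norm_num
  have hpair : ∀ y, G y a + G y b ≤ 1 := by
    intro y
    by_cases hy : y ∈ S
    · obtain ⟨x₀, hx₀, hx⟩ := hS y hy
      by_cases h : a = x₀
      · rw [hx b (fun hb => hne (h.trans hb.symm)), add_zero]; exact hle y a
      · rw [hx a h, zero_add]; exact hle y b
    · rw [hamb y hy, hamb y hy]; norm_num
  have hbip : bip G V = ∑ x, G (f x) x := by
    simp [bip, hf]
  have hrest : ∑ x ∈ univ \ {a, b}, G (f x) x ≤ n - 2 := by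
    calc ∑ x ∈ univ \ {a, b}, G (f x) x ≤ ∑ x ∈ univ \ {a, b}, (1 : ℝ) :=
          sum_le_sum fun x _ => hle _ _
      _ = n - 2 := by
        rw [sum_const, card_sdiff_of_subset (subset_univ _), card_pair hne, card_univ,
          Fintype.card_fin, nsmul_eq_mul, mul_one, Nat.cast_sub hn, Nat.cast_ofNat]
  rw [hbip, ← sum_sdiff (subset_univ {a, b}), sum_pair hne, hcast, ← hab]
  linarith [hpair (f a)]

/-- A channel with two deterministic columns sent to the same output is a convex combination
of deterministic channels that are not injective. -/
lemma IsChannel.mem_signalingPolytope {n n' : ℕ} {P : Matrix (Fin n') (Fin n) ℝ}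
    (hP : IsChannel P) {a b : Fin n} (hab : a ≠ b) (y : Fin n')
    (ha : ∀ z, P z a = if z = y then 1 else 0) (hb : ∀ z, P z b = if z = y then 1 else 0) :
    P ∈ signalingPolytope n n' (n - 1) := by
  let t : Fin n → Set (Fin n' → ℝ) := fun x =>
    if x = a ∨ x = b then {Pi.single y 1} else Set.range fun z => Pi.single z 1
  have hsingle : ∀ x, t x ⊆ Set.range fun z => Pi.single z 1 := by
    intro x
    simp only [t]
    split_ifs
    · rintro _ rfl
      exact ⟨y, rfl⟩
    · exact subset_rfl
  have hmem : (fun x z => P z x) ∈ convexHull ℝ (Set.univ.pi t) := by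
    rw [convexHull_pi]
    intro x _
    by_cases hx : x = a ∨ x = b
    · have hcol : (fun z => P z x) = Pi.single y 1 := by
        funext z
        rcases hx with rfl | rfl
        · rw [ha, Pi.single_apply]
        · rw [hb, Pi.single_apply]
      simp [t, hx, hcol]
    · simp only [t, if_neg hx]
      rw [convexHull_rangle_single_eq_stdSimplex]
      exact ⟨fun z => hP.1 z x, hP.2 x⟩
  let L : (Fin n → Fin n' → ℝ) →ₗ[ℝ] Matrix (Fin n') (Fin n) ℝ :=
    { toFun := fun Q => Matrix.of fun z x => Q x z
      map_add' := fun _ _ => rfl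
      map_smul' := fun _ _ => rfl }
  have himage : P ∈ L '' convexHull ℝ (Set.univ.pi t) := ⟨_, hmem, rfl⟩
  rw [L.image_convexHull] at himage
  refine convexHull_mono ?_ himage
  rintro _ ⟨Q, hQ, rfl⟩
  have hex : ∀ x, ∃ z, Pi.single z 1 = Q x := fun x => hsingle x (hQ x trivial)
  choose f hf using hex
  have hL : ∀ z x, L Q z x = if z = f x then 1 else 0 := by
    intro z x
    change Q x z = _
    rw [← hf, Pi.single_apply]
  have hfix : ∀ x, x = a ∨ x = b → f x = y := by
    intro x hx
    have hQx := hQ x trivial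
    simp only [t, if_pos hx, Set.mem_singleton_iff] at hQx
    have hval := congrFun ((hf x).trans hQx) (f x)
    rw [Pi.single_eq_same, Pi.single_apply] at hval
    by_contra h
    simp [h] at hval
  refine ⟨⟨fun z x => ?_, fun x => ?_⟩, fun z x => ?_, ?_⟩
  · rw [hL]; split_ifs <;> norm_num
  · simp [hL]
  · rw [hL]; split_ifs <;> simp
  · have hsub : {z : Fin n' | ∃ x, L Q z x ≠ 0} ⊆ ↑((univ.erase b).image f) := by
      rintro z ⟨x, hx⟩
      rw [hL] at hx
      have hz : z = f x := by
        by_contra h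
        simp [h] at hx
      simp only [coe_image, Set.mem_image, mem_coe, mem_erase, mem_univ, and_true]
      by_cases hxb : x = b
      · exact ⟨a, hab, by rw [hz, hfix a (Or.inl rfl), hfix x (Or.inr hxb)]⟩
      · exact ⟨x, hxb, hz.symm⟩
    calc _ ≤ _ := Set.ncard_le_ncard hsub (finite_toSet _)
      _ ≤ n - 1 := by
        rw [Set.ncard_coe_finset]
        exact card_image_le.trans (by simp)

/-- Fractional matchings in the rows of a channel, of total weight one, decompose it into
channels that send two inputs to the same output. -/
lemma IsChannel.mem_signalingPolytope_of_matching {n n' : ℕ} {P : Matrix (Fin n') (Fin n) ℝ}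
    (hP : IsChannel P) (w : Fin n' → {p : Fin n × Fin n // p.1 ≠ p.2} → ℝ)
    (hw : ∀ y e, 0 ≤ w y e) (hload : ∀ y x, ∑ e, w y e * pairIncidence e x ≤ P y x)
    (htot : ∑ y, ∑ e, w y e = 1) :
    P ∈ signalingPolytope n n' (n - 1) := by
  let R : Fin n' → Fin n → ℝ := fun y x => P y x - ∑ e, w y e * pairIncidence e x
  have hR : ∀ y x, 0 ≤ R y x := fun y x => sub_nonneg.2 (hload y x)
  have hT : ∀ x, ∃ T : Fin n' → ℝ, (∀ y, 0 ≤ T y) ∧ ∑ y, T y = 1 ∧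
      ∀ y, (∑ z, R z x) * T y = R y x := by
    intro x
    by_cases h : ∑ z, R z x = 0
    · refine ⟨fun y => P y x, fun y => hP.1 y x, hP.2 x, fun y => ?_⟩
      rw [h, zero_mul, (sum_eq_zero_iff_of_nonneg fun z _ => hR z x).1 h y (mem_univ y)]
    · refine ⟨fun y => R y x / ∑ z, R z x,
        fun y => div_nonneg (hR y x) (sum_nonneg fun z _ => hR z x), ?_, fun y => ?_⟩
      · rw [← sum_div, div_self h]
      · field_simp
  choose T hT0 hT1 hTR using hT
  let Q : Fin n' × {p : Fin n × Fin n // p.1 ≠ p.2} → Matrix (Fin n') (Fin n) ℝ := fun i =>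
    Matrix.of fun z x => if x = i.2.1.1 ∨ x = i.2.1.2 then (if z = i.1 then 1 else 0) else T x z
  have hQ : ∀ i, Q i ∈ signalingPolytope n n' (n - 1) := by
    intro i
    refine IsChannel.mem_signalingPolytope ⟨fun z x => ?_, fun x => ?_⟩ i.2.2 i.1 ?_ ?_
    · simp only [Q, Matrix.of_apply]
      split_ifs
      · exact zero_le_one
      · exact le_rfl
      · exact hT0 x z
    · simp only [Q, Matrix.of_apply]
      split_ifs
      · simp
      · exact hT1 x
    · intro z; simp [Q]
    · intro z; simp [Q]
  have hQinc : ∀ i z x, Q i z x = pairIncidence i.2 x * (if z = i.1 then 1 else 0) +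
      (1 - pairIncidence i.2 x) * T x z := by
    rintro ⟨y, e⟩ z x
    have hne := e.2
    simp only [Q, Matrix.of_apply, pairIncidence]
    by_cases hu : x = e.1.1
    · have hv : x ≠ e.1.2 := fun h => hne (hu.symm.trans h)
      rw [if_pos (Or.inl hu), if_pos hu, if_neg hv]
      ring
    · by_cases hv : x = e.1.2
      · rw [if_pos (Or.inr hv), if_neg hu, if_pos hv]
        ring
      · rw [if_neg (not_or.2 ⟨hu, hv⟩), if_neg hu, if_neg hv]
        ring
  have hsum : P = ∑ i, w i.1 i.2 • Q i := by
    ext z x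
    rw [Matrix.sum_apply]
    have hfirst : ∑ y, ∑ e, w y e * (pairIncidence e x * (if z = y then 1 else 0)) =
        ∑ e, w z e * pairIncidence e x := by
      rw [sum_comm]
      simp
    have hcol : ∑ y, R y x = ∑ y, ∑ e, w y e * (1 - pairIncidence e x) := by
      simp only [R, sum_sub_distrib, mul_sub, mul_one, hP.2, htot]
    have hsecond : ∑ y, ∑ e, w y e * ((1 - pairIncidence e x) * T x z) = R z x := by
      rw [← hTR, hcol, sum_mul]
      simp only [sum_mul, mul_assoc]
    simp only [Matrix.smul_apply, smul_eq_mul, hQinc, Fintype.sum_prod_type, mul_add,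
      sum_add_distrib, hfirst, hsecond, R]
    ring
  rw [hsum]
  exact (convex_convexHull ℝ _).sum_mem (fun i _ => hw _ _)
    (by rw [Fintype.sum_prod_type]; exact htot) fun i _ => hQ i

/-- The guessing inequality for an arbitrary set of guessing rows, where `μ y` is a maximizer
of row `y`. -/
lemma sum_two_mul_max_sub_le {n n' : ℕ} (hn : 2 ≤ n) (hnn' : n ≤ n')
    {P : Matrix (Fin n') (Fin n) ℝ}
    (hP : ∀ k ∈ Icc n n', P ∈ ambiguousPolytope n n' k (n - 1)) (μ : Fin n' → Fin n)
    (hμ : ∀ y x, P y x ≤ P y (μ y)) (S : Finset (Fin n')) :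
    ∑ y ∈ S, (2 * P y (μ y) - ∑ x, P y x) ≤ n - 2 := by
  have hch : IsChannel P := (hP n (by simp [hnn'])).1
  have hcast : ((n - 1 : ℕ) : ℝ) = n - 1 := by
    rw [Nat.cast_sub (by omega), Nat.cast_one]
  have hlarge : ∀ S : Finset (Fin n'), n ≤ S.card →
      ∑ y ∈ S, (2 * P y (μ y) - ∑ x, P y x) ≤ n - 2 := by
    intro S hS
    let G : Matrix (Fin n') (Fin n) ℝ := Matrix.of fun y x =>
      if y ∈ S then (if x = μ y then 1 else 0) else 1 / 2
    have hG : IsAmbiguousGame n n' S.card (n - 1) G := by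
      refine ⟨S, rfl, fun y hy => ⟨μ y, by simp [G, hy], fun x hx => by simp [G, hy, hx]⟩,
        fun y hy x => ?_⟩
      rw [hcast]
      simp only [G, Matrix.of_apply, if_neg hy]
      norm_num
    have hbip := (hP S.card (mem_Icc.2 ⟨hS, by simpa using card_le_univ S⟩)).2 G hG
    have hrow : ∀ y, ∑ x, G y x * P y x =
        (∑ x, P y x) / 2 + if y ∈ S then (2 * P y (μ y) - ∑ x, P y x) / 2 else 0 := by
      intro y
      by_cases hy : y ∈ S
      · simp only [G, Matrix.of_apply, if_pos hy, ite_mul, one_mul, zero_mul, sum_ite_eq',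
          mem_univ, if_true]
        ring
      · simp only [G, Matrix.of_apply, if_neg hy, ← mul_sum]
        ring
    rw [bip, sum_comm, sum_congr rfl fun y _ => hrow y, sum_add_distrib, ← sum_div, hch.sum_sum_eq,
      sum_ite_mem, univ_inter, ← sum_div, hcast] at hbip
    linarith
  by_cases hS : n ≤ S.card
  · exact hlarge S hS
  obtain ⟨x, hx⟩ : ∃ x, x ∉ S.image μ := by
    by_contra! h
    have hcard := card_le_card fun x (_ : x ∈ (univ : Finset (Fin n))) => h x
    rw [card_univ, Fintype.card_fin] at hcard
    exact hS (hcard.trans card_image_le)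
  have hfull := hlarge univ (by simpa using hnn')
  rw [sum_sub_distrib, hch.sum_sum_eq, ← mul_sum] at hfull
  have hrow : ∀ y ∈ S, 2 * P y (μ y) - ∑ x, P y x ≤ P y (μ y) - P y x := by
    intro y hy
    have hne : μ y ≠ x := fun h => hx (mem_image.2 ⟨y, hy, h⟩)
    have hs := sum_le_sum_of_subset_of_nonneg (f := fun x => P y x) (subset_univ {μ y, x})
      fun i _ _ => hch.1 y i
    rw [sum_pair hne] at hs
    linarith
  have hrows := sum_le_sum hrow
  rw [sum_sub_distrib (f := fun y => P y (μ y))] at hrows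
  have hcompl : ∑ y ∈ Sᶜ, P y x ≤ ∑ y ∈ Sᶜ, P y (μ y) := sum_le_sum fun y _ => hμ y x
  have e1 := sum_add_sum_compl S fun y => P y x
  have e2 := sum_add_sum_compl S fun y => P y (μ y)
  rw [hch.2] at e1
  linarith

/-- Theorem 1(ii): for `d = n - 1`, the signaling polytope equals the intersection
of the ambiguous polytopes `A_{k,n-1}^{n → n'}` for `n ≤ k ≤ n'`. -/
theorem signalingPolytope_eq_iInter_ambiguousPolytope (n n' : ℕ)
    (hn : 2 ≤ n) (hnn' : n ≤ n') :
    signalingPolytope n n' (n - 1) =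
      ⋂ k ∈ Finset.Icc n n', ambiguousPolytope n n' k (n - 1) := by
  apply Set.Subset.antisymm
  · refine Set.subset_iInter₂ fun k _ => ?_
    exact convexHull_min (fun V hV => hV.mem_ambiguousPolytope hn)
      (convex_ambiguousPolytope n n' k (n - 1))
  intro P hP
  rw [Set.mem_iInter₂] at hP
  have hch : IsChannel P := (hP n (by simp [hnn'])).1
  have : Nonempty (Fin n) := ⟨⟨0, by omega⟩⟩
  choose μ hμ using fun y => Finite.exists_max (P y)
  choose w hw0 hwload hwtot using fun y => exists_large_fractional_matching (P y) (hch.1 y)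
  have hS := sum_two_mul_max_sub_le hn hnn' hP μ hμ
    {y | 0 < 2 * P y (μ y) - ∑ x, P y x}
  rw [sum_filter] at hS
  have hrow : ∀ y, (∑ x, P y x) / 2 - (if 0 < 2 * P y (μ y) - ∑ x, P y x then
      2 * P y (μ y) - ∑ x, P y x else 0) / 2 ≤ ∑ e, w y e := by
    intro y
    rcases hwtot y with h | ⟨x, h⟩
    · split_ifs <;> linarith
    · have hx := hμ y x
      split_ifs <;> linarith
  have hrows := sum_le_sum fun y (_ : y ∈ univ) => hrow y
  rw [sum_sub_distrib, ← sum_div, ← sum_div, hch.sum_sum_eq] at hrows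
  have hW : 1 ≤ ∑ y, ∑ e, w y e := by linarith
  have hWpos : 0 < ∑ y, ∑ e, w y e := by linarith
  refine hch.mem_signalingPolytope_of_matching (fun y e => w y e / ∑ y, ∑ e, w y e)
    (fun y e => div_nonneg (hw0 y e) hWpos.le) (fun y x => ?_) ?_
  · simp only [div_mul_eq_mul_div, ← sum_div]
    exact (div_le_self (sum_nonneg fun e _ => mul_nonneg (hw0 y e) (pairIncidence_nonneg e x))
      hW).trans (hwload y x)
  · simp only [← sum_div]
    exact div_self hWpos.ne'
end

section
/- Theorem 2: Fix the eight 4×6 matrices with bounds: (a) γ=2, G_a = [[1,0,0,0,0,0],[1,0,0,0,0,0],[0,1,0,0,0,0],[0,0,1,0,0,0]]; (b) γ=2, G_b = [[1,0,0,0,0,0],[0,1,0,0,0,0],[0,0,1,0,0,0],[0,0,0,1,0,0]]; (c) γ=3, G_c = [[1,1,0,0,0,0],[1,0,1,0,0,0],[0,1,1,0,0,0],[0,0,0,1,0,0]]; (d) γ=5, G_d = [[1,1,1,0,0,0],[1,0,0,1,1,0],[0,1,0,1,0,1],[0,0,1,0,1,1]]; (e) γ=4, G_e = [[2,0,0,0,0,0],[0,2,0,0,0,0],[0,0,2,0,0,0],[1,1,1,0,0,0]];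 (f) γ=4, G_f = [[2,0,0,0,0,0],[0,2,0,0,0,0],[0,0,1,1,0,0],[1,1,1,0,0,0]]; (g) γ=4, G_g = [[2,0,0,0,0,0],[0,1,0,1,0,0],[0,0,1,0,1,0],[1,1,1,0,0,0]]; (h) γ=4, G_h = [[1,0,0,1,0,0],[0,1,0,0,1,0],[0,0,1,0,0,1],[1,1,1,0,0,0]]. Then for every positive integer n, a channel P ∈ P^{n→4} belongs to C_2^{n→4} if and only if for each of the eight pairs (G_i,γ_i), every permutation π of [4], and every injective map σ from the set of nonzero columns of G_i into [n], it holds that ∑_{j ∈ nonzero columns of G_i} ∑_{y=1}^{4} (G_i)_{y,j} · P(π(y)|σ(j)) ≤ γ_i. -/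
open Finset

attribute [local instance] Classical.propDecidable

/-- The eight generator Bell inequalities `(G_i, γ_i)` of Fig. 3. -/
noncomputable def thm2Games : Fin 8 → (Matrix (Fin 4) (Fin 6) ℝ) × ℝ :=
  ![(!![1,0,0,0,0,0; 1,0,0,0,0,0; 0,1,0,0,0,0; 0,0,1,0,0,0], 2),
    (!![1,0,0,0,0,0; 0,1,0,0,0,0; 0,0,1,0,0,0; 0,0,0,1,0,0], 2),
    (!![1,1,0,0,0,0; 1,0,1,0,0,0; 0,1,1,0,0,0; 0,0,0,1,0,0], 3),
    (!![1,1,1,0,0,0; 1,0,0,1,1,0; 0,1,0,1,0,1; 0,0,1,0,1,1], 5),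
    (!![2,0,0,0,0,0; 0,2,0,0,0,0; 0,0,2,0,0,0; 1,1,1,0,0,0], 4),
    (!![2,0,0,0,0,0; 0,2,0,0,0,0; 0,0,1,1,0,0; 1,1,1,0,0,0], 4),
    (!![2,0,0,0,0,0; 0,1,0,1,0,0; 0,0,1,0,1,0; 1,1,1,0,0,0], 4),
    (!![1,0,0,1,0,0; 0,1,0,0,1,0; 0,0,1,0,0,1; 1,1,1,0,0,0], 4)]

/-- Max-flow min-cut for the complete bipartite network with two sources and two sinks. -/
theorem exists_flow_two_two {r₁ r₂ s₁ s₂ c₁₁ c₁₂ c₂₁ c₂₂ D : ℝ}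
    (hD : 0 ≤ D) (hr₁ : 0 ≤ r₁) (hr₂ : 0 ≤ r₂) (hs₁ : 0 ≤ s₁) (hs₂ : 0 ≤ s₂)
    (h₁₁ : 0 ≤ c₁₁) (h₁₂ : 0 ≤ c₁₂) (h₂₁ : 0 ≤ c₂₁) (h₂₂ : 0 ≤ c₂₂)
    (hc : D ≤ c₁₁ + c₁₂ + c₂₁ + c₂₂)
    (hcr₁ : D ≤ r₁ + c₂₁ + c₂₂) (hcr₂ : D ≤ r₂ + c₁₁ + c₁₂) (hcr : D ≤ r₁ + r₂)
    (hcs₁ : D ≤ s₁ + c₁₂ + c₂₂) (hcs₂ : D ≤ s₂ + c₁₁ + c₂₁) (hcs : D ≤ s₁ + s₂)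
    (hr₁s₁ : D ≤ r₁ + s₁ + c₂₂) (hr₁s₂ : D ≤ r₁ + s₂ + c₂₁)
    (hr₂s₁ : D ≤ r₂ + s₁ + c₁₂) (hr₂s₂ : D ≤ r₂ + s₂ + c₁₁) :
    ∃ x₁₁ x₁₂ x₂₁ x₂₂ : ℝ, 0 ≤ x₁₁ ∧ 0 ≤ x₁₂ ∧ 0 ≤ x₂₁ ∧ 0 ≤ x₂₂ ∧
      x₁₁ ≤ c₁₁ ∧ x₁₂ ≤ c₁₂ ∧ x₂₁ ≤ c₂₁ ∧ x₂₂ ≤ c₂₂ ∧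
      x₁₁ + x₁₂ ≤ r₁ ∧ x₂₁ + x₂₂ ≤ r₂ ∧ x₁₁ + x₂₁ ≤ s₁ ∧ x₁₂ + x₂₂ ≤ s₂ ∧
      x₁₁ + x₁₂ + x₂₁ + x₂₂ = D := by
  obtain ⟨a, hal, hau⟩ : ∃ a, 0 ⊔ (D - r₂) ⊔ (D - c₂₁ - c₂₂) ⊔ (D - s₁ - c₂₂) ⊔
        (D - s₂ - c₂₁) ≤ a ∧
      a ≤ r₁ ⊓ D ⊓ (c₁₁ + c₁₂) ⊓ (s₁ + c₁₂) ⊓ (s₂ + c₁₁) ⊓ (s₁ + s₂) := by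
    refine ⟨_, le_rfl, ?_⟩
    simp only [sup_le_iff, le_inf_iff]
    (repeat' apply And.intro) <;> linarith
  simp only [sup_le_iff, le_inf_iff] at hal hau
  obtain ⟨x, hxl, hxu⟩ : ∃ x, 0 ⊔ (a - c₁₂) ⊔ (D - s₂ - c₂₁) ⊔ (a - s₂) ≤ x ∧
      x ≤ c₁₁ ⊓ a ⊓ s₁ ⊓ (s₁ - (D - a) + c₂₂) := by
    refine ⟨_, le_rfl, ?_⟩
    simp only [sup_le_iff, le_inf_iff]
    (repeat' apply And.intro) <;> linarith
  simp only [sup_le_iff, le_inf_iff] at hxl hxu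
  obtain ⟨y, hyl, hyu⟩ : ∃ y, 0 ⊔ (D - a - c₂₂) ⊔ (D - s₂ - x) ≤ y ∧
      y ≤ c₂₁ ⊓ (D - a) ⊓ (s₁ - x) := by
    refine ⟨_, le_rfl, ?_⟩
    simp only [sup_le_iff, le_inf_iff]
    (repeat' apply And.intro) <;> linarith
  simp only [sup_le_iff, le_inf_iff] at hyl hyu
  refine ⟨x, a - x, y, D - a - y, ?_⟩
  (repeat' apply And.intro) <;> linarith

/-- Fractional matchings of total weight one in `K₄`, with edge capacities `c` and vertex
capacities `t`. -/
theorem exists_fractional_matching_four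
    {t₀ t₁ t₂ t₃ c₀₁ c₀₂ c₀₃ c₁₂ c₁₃ c₂₃ : ℝ}
    (ht₀ : 0 ≤ t₀) (ht₁ : 0 ≤ t₁) (ht₂ : 0 ≤ t₂) (ht₃ : 0 ≤ t₃)
    (h₀₁ : 0 ≤ c₀₁) (h₀₂ : 0 ≤ c₀₂) (h₀₃ : 0 ≤ c₀₃)
    (h₁₂ : 0 ≤ c₁₂) (h₁₃ : 0 ≤ c₁₃) (h₂₃ : 0 ≤ c₂₃)
    (hc : 1 ≤ c₀₁ + c₀₂ + c₀₃ + c₁₂ + c₁₃ + c₂₃)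
    (hv₀ : 1 ≤ t₀ + c₁₂ + c₁₃ + c₂₃) (hv₁ : 1 ≤ t₁ + c₀₂ + c₀₃ + c₂₃)
    (hv₂ : 1 ≤ t₂ + c₀₁ + c₀₃ + c₁₃) (hv₃ : 1 ≤ t₃ + c₀₁ + c₀₂ + c₁₂)
    (hv₀₁ : 1 ≤ t₀ + t₁ + c₂₃) (hv₀₂ : 1 ≤ t₀ + t₂ + c₁₃) (hv₀₃ : 1 ≤ t₀ + t₃ + c₁₂)
    (hv₁₂ : 1 ≤ t₁ + t₂ + c₀₃) (hv₁₃ : 1 ≤ t₁ + t₃ + c₀₂) (hv₂₃ : 1 ≤ t₂ + t₃ + c₀₁)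
    (hn₀ : 1 ≤ t₁ + t₂ + t₃) (hn₁ : 1 ≤ t₀ + t₂ + t₃)
    (hn₂ : 1 ≤ t₀ + t₁ + t₃) (hn₃ : 1 ≤ t₀ + t₁ + t₂)
    (ht : 2 ≤ t₀ + t₁ + t₂ + t₃)
    (hh₀ : 2 ≤ t₁ + t₂ + t₃ + c₀₁ + c₀₂ + c₀₃) (hh₁ : 2 ≤ t₀ + t₂ + t₃ + c₀₁ + c₁₂ + c₁₃)
    (hh₂ : 2 ≤ t₀ + t₁ + t₃ + c₀₂ + c₁₂ + c₂₃) (hh₃ : 2 ≤ t₀ + t₁ + t₂ + c₀₃ + c₁₃ + c₂₃) :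
    ∃ x₀₁ x₀₂ x₀₃ x₁₂ x₁₃ x₂₃ : ℝ,
      (0 ≤ x₀₁ ∧ 0 ≤ x₀₂ ∧ 0 ≤ x₀₃ ∧ 0 ≤ x₁₂ ∧ 0 ≤ x₁₃ ∧ 0 ≤ x₂₃) ∧
      (x₀₁ ≤ c₀₁ ∧ x₀₂ ≤ c₀₂ ∧ x₀₃ ≤ c₀₃ ∧ x₁₂ ≤ c₁₂ ∧ x₁₃ ≤ c₁₃ ∧ x₂₃ ≤ c₂₃) ∧
      (x₀₁ + x₀₂ + x₀₃ ≤ t₀ ∧ x₀₁ + x₁₂ + x₁₃ ≤ t₁ ∧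
        x₀₂ + x₁₂ + x₂₃ ≤ t₂ ∧ x₀₃ + x₁₃ + x₂₃ ≤ t₃) ∧
      x₀₁ + x₀₂ + x₀₃ + x₁₂ + x₁₃ + x₂₃ = 1 := by
  obtain ⟨C, hC⟩ : ∃ C, C = c₀₂ + c₀₃ + c₁₂ + c₁₃ := ⟨_, rfl⟩
  obtain ⟨a, hal, hau⟩ : ∃ a, 0 ⊔ (1 - t₂ - c₀₃ - c₁₃) ⊔ (1 - t₃ - c₀₂ - c₁₂) ⊔
        (1 - C - c₂₃) ⊔ (1 - C - t₂) ⊔ (1 - C - t₃) ⊔ (1 - C / 2 - (t₂ + t₃) / 2) ⊔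
        (2 - C - t₀ - t₂ - t₃) ⊔ (2 - C - t₁ - t₂ - t₃) ⊔ (1 - t₂ - t₃) ⊔
        (2 - t₀ - t₂ - t₃ - c₁₂ - c₁₃) ⊔ (2 - t₁ - t₂ - t₃ - c₀₂ - c₀₃) ≤ a ∧
      a ≤ c₀₁ ⊓ t₀ ⊓ t₁ ⊓ 1 ⊓ (t₀ + t₁ + t₂ - 1) ⊓ (t₀ + t₁ + t₃ - 1) ⊓
        (t₀ + c₁₂ + c₁₃) ⊓ (t₁ + c₀₂ + c₀₃) ⊓ (t₀ + t₁ + t₂ + t₃ - 1) ⊓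
        (2 * t₀ + t₁ + t₂ + t₃ + c₁₂ + c₁₃ - 2) ⊓ (2 * t₁ + t₀ + t₂ + t₃ + c₀₂ + c₀₃ - 2) ⊓
        ((t₀ + t₁) / 2) ⊓ (t₀ + t₁ + c₂₃ - 1) ⊓ (2 * t₀ + t₁ + t₂ + t₃ - 2) ⊓
        (t₀ + 2 * t₁ + t₂ + t₃ - 2) ⊓ (t₀ + t₁ + (t₂ + t₃) / 2 - 1) := by
    refine ⟨_, le_rfl, ?_⟩
    simp only [sup_le_iff, le_inf_iff]
    (repeat' apply And.intro) <;> linarith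
  simp only [sup_le_iff, le_inf_iff] at hal hau
  obtain ⟨b, hbl, hbu⟩ : ∃ b, 0 ⊔ (1 - a - C) ⊔ (1 - t₀ - c₁₂ - c₁₃) ⊔ (1 - t₁ - c₀₂ - c₀₃) ⊔
        (1 + a - t₀ - t₁) ≤ b ∧
      b ≤ c₂₃ ⊓ t₂ ⊓ t₃ ⊓ (1 - a) ⊓ (t₂ + t₃ - 1 + a) ⊓ (t₀ + t₂ + t₃ - 1) ⊓
        (t₁ + t₂ + t₃ - 1) ⊓ (t₀ + t₁ + t₂ + t₃ - 1 - a) := by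
    refine ⟨_, le_rfl, ?_⟩
    simp only [sup_le_iff, le_inf_iff]
    (repeat' apply And.intro) <;> linarith
  simp only [sup_le_iff, le_inf_iff] at hbl hbu
  obtain ⟨x₀₂, x₀₃, x₁₂, x₁₃, hx⟩ := exists_flow_two_two (r₁ := t₀ - a) (r₂ := t₁ - a)
    (s₁ := t₂ - b) (s₂ := t₃ - b) (D := 1 - a - b)
    (by linarith) (by linarith) (by linarith) (by linarith) (by linarith) h₀₂ h₀₃ h₁₂ h₁₃
    (by linarith) (by linarith) (by linarith) (by linarith) (by linarith) (by linarith)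
    (by linarith) (by linarith) (by linarith) (by linarith) (by linarith)
  refine ⟨a, x₀₂, x₀₃, x₁₂, x₁₃, b, ?_⟩
  (repeat' apply And.intro) <;> linarith

/-- A vector lies in the weighted Minkowski sum of the edges of the tetrahedron as soon as each
set of coordinates carries at least the weight of the edges it contains. -/
theorem exists_edge_shares
    {p₀ p₁ p₂ p₃ w₀₁ w₀₂ w₀₃ w₁₂ w₁₃ w₂₃ : ℝ}
    (hp₀ : 0 ≤ p₀) (hp₁ : 0 ≤ p₁) (hp₂ : 0 ≤ p₂) (hp₃ : 0 ≤ p₃)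
    (h₀₁ : 0 ≤ w₀₁) (h₀₂ : 0 ≤ w₀₂) (h₀₃ : 0 ≤ w₀₃)
    (h₁₂ : 0 ≤ w₁₂) (h₁₃ : 0 ≤ w₁₃) (h₂₃ : 0 ≤ w₂₃)
    (hw₀₁ : w₀₁ ≤ p₀ + p₁) (hw₀₂ : w₀₂ ≤ p₀ + p₂) (hw₀₃ : w₀₃ ≤ p₀ + p₃)
    (hw₁₂ : w₁₂ ≤ p₁ + p₂) (hw₁₃ : w₁₃ ≤ p₁ + p₃) (hw₂₃ : w₂₃ ≤ p₂ + p₃)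
    (ht₀ : w₁₂ + w₁₃ + w₂₃ ≤ p₁ + p₂ + p₃) (ht₁ : w₀₂ + w₀₃ + w₂₃ ≤ p₀ + p₂ + p₃)
    (ht₂ : w₀₁ + w₀₃ + w₁₃ ≤ p₀ + p₁ + p₃) (ht₃ : w₀₁ + w₀₂ + w₁₂ ≤ p₀ + p₁ + p₂)
    (hw : w₀₁ + w₀₂ + w₀₃ + w₁₂ + w₁₃ + w₂₃ = p₀ + p₁ + p₂ + p₃) :
    ∃ f₀₁ f₀₂ f₀₃ f₁₂ f₁₃ f₂₃ : ℝ,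
      (0 ≤ f₀₁ ∧ 0 ≤ f₀₂ ∧ 0 ≤ f₀₃ ∧ 0 ≤ f₁₂ ∧ 0 ≤ f₁₃ ∧ 0 ≤ f₂₃) ∧
      (f₀₁ ≤ w₀₁ ∧ f₀₂ ≤ w₀₂ ∧ f₀₃ ≤ w₀₃ ∧ f₁₂ ≤ w₁₂ ∧ f₁₃ ≤ w₁₃ ∧ f₂₃ ≤ w₂₃) ∧
      p₀ = f₀₁ + f₀₂ + f₀₃ ∧ p₁ = (w₀₁ - f₀₁) + f₁₂ + f₁₃ ∧
      p₂ = (w₀₂ - f₀₂) + (w₁₂ - f₁₂) + f₂₃ ∧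
      p₃ = (w₀₃ - f₀₃) + (w₁₃ - f₁₃) + (w₂₃ - f₂₃) := by
  obtain ⟨a, hal, hau⟩ : ∃ a, 0 ⊔ (w₀₁ - p₁) ⊔ (w₀₁ + w₁₂ - p₁ - p₂) ⊔ (w₀₁ - p₁ - w₂₃) ⊔
        (p₀ - w₀₃ - w₀₂) ⊔ (p₀ - w₀₃ - w₀₂ + p₂ - w₁₂ - w₂₃) ≤ a ∧
      a ≤ w₀₁ ⊓ (w₀₁ - p₁ + w₁₂ + w₁₃) ⊓ p₀ ⊓ (p₀ - w₀₂ + p₂) ⊓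
        (w₀₁ + w₀₂ - p₁ - p₂ + w₁₂ + w₁₃ + w₂₃) ⊓ (w₀₁ - p₁ + w₁₂ + w₁₃ + w₂₃) := by
    refine ⟨_, le_rfl, ?_⟩
    simp only [sup_le_iff, le_inf_iff]
    (repeat' apply And.intro) <;> linarith
  simp only [sup_le_iff, le_inf_iff] at hal hau
  obtain ⟨b, hbl, hbu⟩ : ∃ b, 0 ⊔ (w₀₂ - p₂) ⊔ (w₀₁ + w₀₂ + w₁₂ - p₁ - p₂ - a) ⊔
        (p₀ - w₀₃ - a) ≤ b ∧
      b ≤ w₀₂ ⊓ (w₀₂ - p₂ + w₁₂ + w₂₃) ⊓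
        (w₀₁ + w₀₂ - p₁ - p₂ + w₁₂ + w₁₃ + w₂₃ - a) ⊓ (p₀ - a) := by
    refine ⟨_, le_rfl, ?_⟩
    simp only [sup_le_iff, le_inf_iff]
    (repeat' apply And.intro) <;> linarith
  simp only [sup_le_iff, le_inf_iff] at hbl hbu
  obtain ⟨f, hfl, hfu⟩ : ∃ f, 0 ⊔ (p₁ - w₀₁ + a - w₁₃) ⊔ (w₁₂ - (p₂ - w₀₂ + b)) ≤ f ∧
      f ≤ w₁₂ ⊓ (p₁ - w₀₁ + a) ⊓ (w₂₃ + w₁₂ - (p₂ - w₀₂ + b)) := by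
    refine ⟨_, le_rfl, ?_⟩
    simp only [sup_le_iff, le_inf_iff]
    (repeat' apply And.intro) <;> linarith
  simp only [sup_le_iff, le_inf_iff] at hfl hfu
  refine ⟨a, b, p₀ - a - b, f, p₁ - w₀₁ + a - f, p₂ - w₀₂ + b - w₁₂ + f, ?_⟩
  (repeat' apply And.intro) <;> linarith

/-- A channel all of whose outputs lie in a set of at most `d` rows is in the signaling polytope. -/
theorem IsChannel.mem_signalingPolytope_s2 {n n' d : ℕ} {Q : Matrix (Fin n') (Fin n) ℝ}
    (hQ : IsChannel Q) (T : Finset (Fin n')) (hT : T.card ≤ d)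
    (hz : ∀ y, y ∉ T → ∀ x, Q y x = 0) : Q ∈ signalingPolytope n n' d := by
  set s : Set (Fin n' → ℝ) := (fun y => Pi.single y (1 : ℝ)) '' (T : Set (Fin n'))
  have hmem : (fun x y => Q y x) ∈ convexHull ℝ (Set.univ.pi fun _ : Fin n => s) := by
    rw [convexHull_pi]
    intro x _
    have hsum : ∑ y ∈ T, Q y x = 1 := by
      rw [← hQ.2 x]
      exact Finset.sum_subset (Finset.subset_univ T) fun y _ hy => hz y hy x
    have hcol : (fun y => Q y x) = ∑ y ∈ T, Q y x • Pi.single y (1 : ℝ) := by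
      ext y
      simp only [Finset.sum_apply, Pi.smul_apply, Pi.single_apply,
        smul_eq_mul, mul_ite, mul_one, mul_zero, Finset.sum_ite_eq]
      split_ifs with hy
      · rfl
      · exact hz y hy x
    change (fun y => Q y x) ∈ convexHull ℝ s
    rw [hcol]
    exact (convex_convexHull ℝ s).sum_mem (fun y _ => hQ.1 y x) hsum fun y hy =>
      subset_convexHull ℝ s ⟨y, hy, rfl⟩
  have hconv : Convex ℝ {V : Fin n → Fin n' → ℝ |
      (Matrix.of fun y x => V x y) ∈ signalingPolytope n n' d} :=
    (convex_convexHull ℝ _).is_linear_preimage ⟨fun _ _ => rfl, fun _ _ => rfl⟩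
  refine convexHull_min ?_ hconv hmem
  intro V hV
  choose f hf hfV using fun x => hV x (Set.mem_univ x)
  have hval : ∀ y x, V x y = if y = f x then 1 else 0 := by
    intro y x
    rw [← hfV x]
    exact Pi.single_apply (f x) (1 : ℝ) y
  refine subset_convexHull ℝ _ ?_
  refine ⟨⟨fun y x => ?_, fun x => ?_⟩, fun y x => ?_, ?_⟩
  · change 0 ≤ V x y
    rw [hval]
    split_ifs <;> norm_num
  · change ∑ y, V x y = 1
    simp [hval]
  · change V x y = 0 ∨ V x y = 1
    rw [hval]
    split_ifs <;> simp
  · refine le_trans ?_ hT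
    rw [← Set.ncard_coe_finset T]
    refine Set.ncard_le_ncard ?_ T.finite_toSet
    rintro y ⟨x, hx⟩
    change V x y ≠ 0 at hx
    rw [hval] at hx
    have hy : y = f x := by
      by_contra hne
      simp [hne] at hx
    exact hy ▸ hf x

/-- A sum of nonnegative matrices, each with constant column sums and supported on at most `d`
rows, is in the signaling polytope if the column sums add up to one. -/
theorem sum_mem_signalingPolytope {ι : Type*} [Fintype ι] {n n' d : ℕ}
    (W : ι → Matrix (Fin n') (Fin n) ℝ) (w : ι → ℝ) (T : ι → Finset (Fin n'))
    (hT : ∀ k, (T k).card ≤ d) (hW : ∀ k y x, 0 ≤ W k y x) (hWw : ∀ k x, ∑ y, W k y x = w k)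
    (hz : ∀ k y, y ∉ T k → ∀ x, W k y x = 0) (hw : ∀ k, 0 ≤ w k) (hw1 : ∑ k, w k = 1) :
    ∑ k, W k ∈ signalingPolytope n n' d := by
  have hzero : ∀ k, w k = 0 → W k = 0 := by
    intro k hk
    ext y x
    have hsum := hWw k x
    rw [hk, Finset.sum_eq_zero_iff_of_nonneg fun y _ => hW k y x] at hsum
    exact hsum y (Finset.mem_univ y)
  have hrepr : ∑ k, W k = ∑ k with w k ≠ 0, w k • ((w k)⁻¹ • W k) := by
    rw [Finset.sum_filter]
    refine Finset.sum_congr rfl fun k _ => ?_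
    split_ifs with hk
    · rw [smul_smul, mul_inv_cancel₀ hk, one_smul]
    · exact hzero k (not_not.mp hk)
  rw [hrepr]
  refine (convex_convexHull ℝ _).sum_mem (fun k _ => hw k) ?_ fun k hk => ?_
  · rw [Finset.sum_filter_ne_zero, hw1]
  · have hk' : w k ≠ 0 := (Finset.mem_filter.mp hk).2
    refine IsChannel.mem_signalingPolytope_s2 ⟨fun y x => ?_, fun x => ?_⟩ (T k) (hT k) ?_
    · exact mul_nonneg (inv_nonneg.mpr (hw k)) (hW k y x)
    · simp only [Matrix.smul_apply, smul_eq_mul]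
      rw [← Finset.mul_sum, hWw, inv_mul_cancel₀ hk']
    · intro y hy x
      simp [hz k y hy x]

/-- Zero columns of a game do not contribute to its score. -/
theorem sum_nonzero_columns (G : Matrix (Fin 4) (Fin 6) ℝ) (Q : Fin 4 → Fin 6 → ℝ) :
    ∑ j ∈ Finset.univ.filter (fun j => ∃ y, G y j ≠ 0), ∑ y, G y j * Q y j =
      ∑ j, ∑ y, G y j * Q y j := by
  refine Finset.sum_filter_of_ne fun j _ hj => ?_
  by_contra! hG
  exact hj (Finset.sum_eq_zero fun y _ => by rw [hG y, zero_mul])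

set_option maxHeartbeats 4000000 in
/-- Channels with two possible outputs respect the bounds of the eight games. -/
theorem thm2Games_le_of_two_rows (i : Fin 8) (Q : Fin 4 → Fin 6 → ℝ) (hQ : ∀ y j, 0 ≤ Q y j)
    (hsum : ∀ j, ∑ y, Q y j = 1) (a b : Fin 4) (hz : ∀ y, y ≠ a → y ≠ b → ∀ j, Q y j = 0) :
    ∑ j, ∑ y, (thm2Games i).1 y j * Q y j ≤ (thm2Games i).2 := by
  simp only [Fin.sum_univ_four, Fin.sum_univ_six, Fin.forall_fin_succ, Fin.succ_zero_eq_one,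
    Fin.succ_one_eq_two, IsEmpty.forall_iff, and_true] at hQ hsum hz ⊢
  fin_cases i <;> fin_cases a <;> fin_cases b <;> simp [thm2Games] at hQ hsum hz ⊢ <;> linarith

theorem thm2Games_le_of_mem_signalingPolytope {n : ℕ} {P : Matrix (Fin 4) (Fin n) ℝ}
    (hP : P ∈ signalingPolytope n 4 2) (i : Fin 8) (π : Equiv.Perm (Fin 4))
    (σ : Fin 6 → Fin n) :
    ∑ j, ∑ y, (thm2Games i).1 y j * P (π y) (σ j) ≤ (thm2Games i).2 := by
  have hconv : Convex ℝ {Q : Matrix (Fin 4) (Fin n) ℝ |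
      ∑ j, ∑ y, (thm2Games i).1 y j * Q (π y) (σ j) ≤ (thm2Games i).2} := by
    refine convex_halfSpace_le ⟨fun Q R => ?_, fun c Q => ?_⟩ _
    · simp [mul_add, Finset.sum_add_distrib]
    · simp [Finset.mul_sum, mul_left_comm]
  refine convexHull_min ?_ hconv hP
  rintro V ⟨hV, -, hcard⟩
  obtain ⟨T, hT, hTcard⟩ : ∃ T : Finset (Fin 4), {y | ∃ x, V y x ≠ 0} ⊆ (T : Set (Fin 4)) ∧
      T.card = 2 := by
    rw [Set.ncard_eq_toFinset_card'] at hcard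
    obtain ⟨T, hT, hTcard⟩ := Finset.exists_superset_card_eq hcard (by simp)
    exact ⟨T, fun y hy => hT (by simpa using hy), hTcard⟩
  obtain ⟨a, b, -, rfl⟩ := Finset.card_eq_two.mp hTcard
  refine thm2Games_le_of_two_rows i (fun y j => V (π y) (σ j)) (fun y j => hV.1 _ _)
    (fun j => (Equiv.sum_comp π fun y => V y (σ j)).trans (hV.2 _)) (π.symm a) (π.symm b) ?_
  intro y hya hyb j
  by_contra hne
  have hy := hT ⟨σ j, hne⟩
  simp only [Finset.coe_insert, Finset.coe_singleton, Set.mem_insert_iff,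
    Set.mem_singleton_iff] at hy
  rcases hy with hy | hy
  · exact hya (by rw [← hy, Equiv.symm_apply_apply])
  · exact hyb (by rw [← hy, Equiv.symm_apply_apply])

theorem IsChannel.bounds {n : ℕ} {P : Matrix (Fin 4) (Fin n) ℝ} (hP : IsChannel P)
    {a b c d : Fin 4} (hd : [a, b, c, d].Nodup) (x : Fin n) :
    0 ≤ P a x ∧ 0 ≤ P b x ∧ 0 ≤ P c x ∧ 0 ≤ P d x ∧ P a x + P b x + P c x + P d x = 1 := by
  refine ⟨hP.1 a x, hP.1 b x, hP.1 c x, hP.1 d x, ?_⟩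
  have huniv : (Finset.univ : Finset (Fin 4)) = {a, b, c, d} :=
    (Finset.eq_univ_of_card _ (by simpa using List.toFinset_card_of_nodup hd)).symm
  simp only [List.nodup_cons, List.mem_cons, List.not_mem_nil, or_false, not_or] at hd
  have hsum := hP.2 x
  rw [huniv, Finset.sum_insert (by simp_all), Finset.sum_insert (by simp_all),
    Finset.sum_pair (by simp_all)] at hsum
  linarith

/-- The eight inequalities under every output permutation, on injectively chosen inputs. -/
def SatisfiesGames {n : ℕ} (P : Matrix (Fin 4) (Fin n) ℝ) : Prop :=
  ∀ (i : Fin 8) (π : Equiv.Perm (Fin 4)) (σ : Fin 6 → Fin n),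
    Set.InjOn σ {j | ∃ y, (thm2Games i).1 y j ≠ 0} →
    ∑ j, ∑ y, (thm2Games i).1 y j * P (π y) (σ j) ≤ (thm2Games i).2

namespace SatisfiesGames

variable {n : ℕ} {P : Matrix (Fin 4) (Fin n) ℝ}

/-- The inequalities hold for any labelling of the four outputs and any inputs which are distinct
on a set containing the nonzero columns. -/
theorem of_nodup (h : SatisfiesGames P) (i : Fin 8) {a b c d : Fin 4} (hd : [a, b, c, d].Nodup)
    (σ : Fin 6 → Fin n) (k : ℕ) (hk : ∀ j : Fin 6, k ≤ j → ∀ y, (thm2Games i).1 y j = 0)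
    (hσ : ∀ j l : Fin 6, j < l → (l : ℕ) < k → σ j ≠ σ l) :
    ∑ j, ∑ y, (thm2Games i).1 y j * P (![a, b, c, d] y) (σ j) ≤ (thm2Games i).2 := by
  have hinj : Function.Injective ![a, b, c, d] := by
    simp only [List.nodup_cons, List.mem_cons, List.not_mem_nil, or_false, not_or] at hd
    intro y z hyz
    fin_cases y <;> fin_cases z <;> simp_all
  have hlt : ∀ j ∈ {j | ∃ y, (thm2Games i).1 y j ≠ 0}, (j : ℕ) < k := by
    rintro j ⟨y, hy⟩
    by_contra! hj
    exact hy (hk j hj y)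
  refine h i (Equiv.ofBijective _ (Finite.injective_iff_bijective.mp hinj)) σ fun j hj l hl hjl => ?_
  rcases lt_trichotomy j l with hlt' | rfl | hlt'
  · exact absurd hjl (hσ j l hlt' (hlt l hl))
  · rfl
  · exact absurd hjl.symm (hσ l j hlt' (hlt j hj))

theorem game_a (h : SatisfiesGames P) {a b c d : Fin 4} (hd : [a, b, c, d].Nodup)
    {x₁ x₂ x₃ : Fin n} (hx : [x₁, x₂, x₃].Nodup) :
    (P a x₁ + P b x₁) + P c x₂ + P d x₃ ≤ 2 := by
  have hle := h.of_nodup 0 hd ![x₁, x₂, x₃, x₁, x₁, x₁] 3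
    (by simp [thm2Games, Fin.forall_fin_succ])
    (by simp_all [Fin.forall_fin_succ])
  simp [thm2Games, Fin.sum_univ_succ] at hle
  linarith

theorem game_b (h : SatisfiesGames P) {a b c d : Fin 4} (hd : [a, b, c, d].Nodup)
    {x₁ x₂ x₃ x₄ : Fin n} (hx : [x₁, x₂, x₃, x₄].Nodup) :
    P a x₁ + P b x₂ + P c x₃ + P d x₄ ≤ 2 := by
  have hle := h.of_nodup 1 hd ![x₁, x₂, x₃, x₄, x₁, x₁] 4
    (by simp [thm2Games, Fin.forall_fin_succ])
    (by simp_all [Fin.forall_fin_succ])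
  simp [thm2Games, Fin.sum_univ_succ] at hle
  linarith

theorem game_c (h : SatisfiesGames P) {a b c d : Fin 4} (hd : [a, b, c, d].Nodup)
    {x₁ x₂ x₃ x₄ : Fin n} (hx : [x₁, x₂, x₃, x₄].Nodup) :
    (P a x₁ + P b x₁) + (P a x₂ + P c x₂) + (P b x₃ + P c x₃) + P d x₄ ≤ 3 := by
  have hle := h.of_nodup 2 hd ![x₁, x₂, x₃, x₄, x₁, x₁] 4
    (by simp [thm2Games, Fin.forall_fin_succ])
    (by simp_all [Fin.forall_fin_succ])
  simp [thm2Games, Fin.sum_univ_succ] at hle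
  linarith

theorem game_d (h : SatisfiesGames P) {a b c d : Fin 4} (hd : [a, b, c, d].Nodup)
    {x₁ x₂ x₃ x₄ x₅ x₆ : Fin n} (hx : [x₁, x₂, x₃, x₄, x₅, x₆].Nodup) :
    (P a x₁ + P b x₁) + (P a x₂ + P c x₂) + (P a x₃ + P d x₃) +
      (P b x₄ + P c x₄) + (P b x₅ + P d x₅) + (P c x₆ + P d x₆) ≤ 5 := by
  have hle := h.of_nodup 3 hd ![x₁, x₂, x₃, x₄, x₅, x₆] 6
    (by simp [thm2Games, Fin.forall_fin_succ])
    (by simp_all [Fin.forall_fin_succ])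
  simp [thm2Games, Fin.sum_univ_succ] at hle
  linarith

theorem game_e (h : SatisfiesGames P) {a b c d : Fin 4} (hd : [a, b, c, d].Nodup)
    {x₁ x₂ x₃ : Fin n} (hx : [x₁, x₂, x₃].Nodup) :
    (2 * P a x₁ + P d x₁) + (2 * P b x₂ + P d x₂) + (2 * P c x₃ + P d x₃) ≤ 4 := by
  have hle := h.of_nodup 4 hd ![x₁, x₂, x₃, x₁, x₁, x₁] 3
    (by simp [thm2Games, Fin.forall_fin_succ])
    (by simp_all [Fin.forall_fin_succ])
  simp [thm2Games, Fin.sum_univ_succ] at hle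
  linarith

theorem game_f (h : SatisfiesGames P) {a b c d : Fin 4} (hd : [a, b, c, d].Nodup)
    {x₁ x₂ x₃ x₄ : Fin n} (hx : [x₁, x₂, x₃, x₄].Nodup) :
    (2 * P a x₁ + P d x₁) + (2 * P b x₂ + P d x₂) + (P c x₃ + P d x₃) + P c x₄ ≤ 4 := by
  have hle := h.of_nodup 5 hd ![x₁, x₂, x₃, x₄, x₁, x₁] 4
    (by simp [thm2Games, Fin.forall_fin_succ])
    (by simp_all [Fin.forall_fin_succ])
  simp [thm2Games, Fin.sum_univ_succ] at hle
  linarith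

theorem game_g (h : SatisfiesGames P) {a b c d : Fin 4} (hd : [a, b, c, d].Nodup)
    {x₁ x₂ x₃ x₄ x₅ : Fin n} (hx : [x₁, x₂, x₃, x₄, x₅].Nodup) :
    (2 * P a x₁ + P d x₁) + (P b x₂ + P d x₂) + (P c x₃ + P d x₃) + P b x₄ + P c x₅ ≤ 4 := by
  have hle := h.of_nodup 6 hd ![x₁, x₂, x₃, x₄, x₅, x₁] 5
    (by simp [thm2Games, Fin.forall_fin_succ])
    (by simp_all [Fin.forall_fin_succ])
  simp [thm2Games, Fin.sum_univ_succ] at hle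
  linarith

theorem game_h (h : SatisfiesGames P) {a b c d : Fin 4} (hd : [a, b, c, d].Nodup)
    {x₁ x₂ x₃ x₄ x₅ x₆ : Fin n} (hx : [x₁, x₂, x₃, x₄, x₅, x₆].Nodup) :
    (P a x₁ + P d x₁) + (P b x₂ + P d x₂) + (P c x₃ + P d x₃) +
      P a x₄ + P b x₅ + P c x₆ ≤ 4 := by
  have hle := h.of_nodup 7 hd ![x₁, x₂, x₃, x₄, x₅, x₆] 6
    (by simp [thm2Games, Fin.forall_fin_succ])
    (by simp_all [Fin.forall_fin_succ])
  simp [thm2Games, Fin.sum_univ_succ] at hle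
  linarith

/-! The inequalities without the restriction to distinct inputs. -/

theorem two_add_one_add_one_le (h : SatisfiesGames P) (hP : IsChannel P) {a b c d : Fin 4}
    (hd : [a, b, c, d].Nodup) (x y z : Fin n) :
    P a x + P b x + P c y + P d z ≤ 2 := by
  obtain ⟨_, _, _, _, _⟩ := hP.bounds hd x
  obtain ⟨_, _, _, _, _⟩ := hP.bounds hd y
  obtain ⟨_, _, _, _, _⟩ := hP.bounds hd z
  by_cases hxy : x = y
  · subst hxy; linarith
  by_cases hxz : x = z
  · subst hxz; linarith
  by_cases hyz : y = z
  · subst hyz; linarith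
  exact h.game_a hd (by simp_all)

theorem four_singles_le (h : SatisfiesGames P) (hP : IsChannel P) {a b c d : Fin 4}
    (hd : [a, b, c, d].Nodup) (x y z w : Fin n) :
    P a x + P b y + P c z + P d w ≤ 2 := by
  have key := @two_add_one_add_one_le n P h hP
  by_cases hxy : x = y
  · subst hxy; exact key hd x z w
  by_cases hxz : x = z
  · subst hxz; linarith [key (a := a) (b := c) (c := b) (d := d) (by grind) x y w]
  by_cases hxw : x = w
  · subst hxw; linarith [key (a := a) (b := d) (c := b) (d := c) (by grind) x y z]
  by_cases hyz : y = z
  · subst hyz; linarith [key (a := b) (b := c) (c := a) (d := d) (by grind) y x w]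
  by_cases hyw : y = w
  · subst hyw; linarith [key (a := b) (b := d) (c := a) (d := c) (by grind) y x z]
  by_cases hzw : z = w
  · subst hzw; linarith [key (a := c) (b := d) (c := a) (d := b) (by grind) z x y]
  exact h.game_b hd (by simp_all)

theorem triangle_add_one_le (h : SatisfiesGames P) (hP : IsChannel P) {a b c d : Fin 4}
    (hd : [a, b, c, d].Nodup) (x y z w : Fin n) :
    (P a x + P b x) + (P a y + P c y) + (P b z + P c z) + P d w ≤ 3 := by
  have key := @two_add_one_add_one_le n P h hP
  obtain ⟨_, _, _, _, _⟩ := hP.bounds hd x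
  obtain ⟨_, _, _, _, _⟩ := hP.bounds hd y
  obtain ⟨_, _, _, _, _⟩ := hP.bounds hd z
  obtain ⟨_, _, _, _, _⟩ := hP.bounds hd w
  by_cases hxw : x = w
  · subst hxw; linarith
  by_cases hyw : y = w
  · subst hyw; linarith
  by_cases hzw : z = w
  · subst hzw; linarith
  by_cases hxy : x = y
  · subst hxy; linarith [key (a := b) (b := c) (c := a) (d := d) (by grind) z x w]
  by_cases hxz : x = z
  · subst hxz; linarith [key (a := a) (b := c) (c := b) (d := d) (by grind) y x w]
  by_cases hyz : y = z
  · subst hyz; linarith [key (a := a) (b := b) (c := c) (d := d) (by grind) x y w]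
  exact h.game_c hd (by simp_all)

theorem six_pairs_le (h : SatisfiesGames P) (hP : IsChannel P) {a b c d : Fin 4}
    (hd : [a, b, c, d].Nodup) (x₁ x₂ x₃ x₄ x₅ x₆ : Fin n) :
    (P a x₁ + P b x₁) + (P a x₂ + P c x₂) + (P a x₃ + P d x₃) +
      (P b x₄ + P c x₄) + (P b x₅ + P d x₅) + (P c x₆ + P d x₆) ≤ 5 := by
  have key := @triangle_add_one_le n P h hP
  obtain ⟨_, _, _, _, _⟩ := hP.bounds hd x₁
  obtain ⟨_, _, _, _, _⟩ := hP.bounds hd x₂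
  obtain ⟨_, _, _, _, _⟩ := hP.bounds hd x₃
  obtain ⟨_, _, _, _, _⟩ := hP.bounds hd x₄
  obtain ⟨_, _, _, _, _⟩ := hP.bounds hd x₅
  obtain ⟨_, _, _, _, _⟩ := hP.bounds hd x₆
  by_cases h₁₆ : x₁ = x₆
  · subst h₁₆; linarith
  by_cases h₂₅ : x₂ = x₅
  · subst h₂₅; linarith
  by_cases h₃₄ : x₃ = x₄
  · subst h₃₄; linarith
  by_cases h₁₂ : x₁ = x₂
  · subst h₁₂; linarith [key (a := b) (b := c) (c := d) (d := a) (by grind) x₄ x₅ x₆ x₁]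
  by_cases h₁₃ : x₁ = x₃
  · subst h₁₃; linarith [key (a := b) (b := c) (c := d) (d := a) (by grind) x₄ x₅ x₆ x₁]
  by_cases h₂₃ : x₂ = x₃
  · subst h₂₃; linarith [key (a := b) (b := c) (c := d) (d := a) (by grind) x₄ x₅ x₆ x₂]
  by_cases h₁₄ : x₁ = x₄
  · subst h₁₄; linarith [key (a := a) (b := c) (c := d) (d := b) (by grind) x₂ x₃ x₆ x₁]
  by_cases h₁₅ : x₁ = x₅
  · subst h₁₅; linarith [key (a := a) (b := c) (c := d) (d := b) (by grind) x₂ x₃ x₆ x₁]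
  by_cases h₄₅ : x₄ = x₅
  · subst h₄₅; linarith [key (a := a) (b := c) (c := d) (d := b) (by grind) x₂ x₃ x₆ x₄]
  by_cases h₂₄ : x₂ = x₄
  · subst h₂₄; linarith [key (a := a) (b := b) (c := d) (d := c) (by grind) x₁ x₃ x₅ x₂]
  by_cases h₂₆ : x₂ = x₆
  · subst h₂₆; linarith [key (a := a) (b := b) (c := d) (d := c) (by grind) x₁ x₃ x₅ x₂]
  by_cases h₄₆ : x₄ = x₆
  · subst h₄₆; linarith [key (a := a) (b := b) (c := d) (d := c) (by grind) x₁ x₃ x₅ x₄]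
  by_cases h₃₅ : x₃ = x₅
  · subst h₃₅; linarith [key (a := a) (b := b) (c := c) (d := d) (by grind) x₁ x₂ x₄ x₃]
  by_cases h₃₆ : x₃ = x₆
  · subst h₃₆; linarith [key (a := a) (b := b) (c := c) (d := d) (by grind) x₁ x₂ x₄ x₃]
  by_cases h₅₆ : x₅ = x₆
  · subst h₅₆; linarith [key (a := a) (b := b) (c := c) (d := d) (by grind) x₁ x₂ x₄ x₅]
  exact h.game_d hd (by simp_all)

theorem three_singles_add_star_le (h : SatisfiesGames P) (hP : IsChannel P) {a b c d : Fin 4}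
    (hd : [a, b, c, d].Nodup) (x₁ x₂ x₃ x₄ x₅ x₆ : Fin n) :
    (P a x₁ + P d x₁) + (P b x₂ + P d x₂) + (P c x₃ + P d x₃) +
      P a x₄ + P b x₅ + P c x₆ ≤ 4 := by
  have keyA := @two_add_one_add_one_le n P h hP
  have keyB := @four_singles_le n P h hP
  have keyC := @triangle_add_one_le n P h hP
  obtain ⟨_, _, _, _, _⟩ := hP.bounds hd x₁
  obtain ⟨_, _, _, _, _⟩ := hP.bounds hd x₂
  obtain ⟨_, _, _, _, _⟩ := hP.bounds hd x₃
  obtain ⟨_, _, _, _, _⟩ := hP.bounds hd x₄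
  obtain ⟨_, _, _, _, _⟩ := hP.bounds hd x₅
  obtain ⟨_, _, _, _, _⟩ := hP.bounds hd x₆
  by_cases h₄₅ : x₄ = x₅
  · subst h₄₅; linarith [keyC (a := a) (b := b) (c := d) (d := c) (by grind) x₄ x₁ x₂ x₆]
  by_cases h₄₆ : x₄ = x₆
  · subst h₄₆; linarith [keyC (a := a) (b := c) (c := d) (d := b) (by grind) x₄ x₁ x₃ x₅]
  by_cases h₅₆ : x₅ = x₆
  · subst h₅₆; linarith [keyC (a := b) (b := c) (c := d) (d := a) (by grind) x₅ x₂ x₃ x₄]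
  by_cases h₁₂ : x₁ = x₂
  · subst h₁₂; linarith [keyB hd x₄ x₅ x₆ x₁]
  by_cases h₁₃ : x₁ = x₃
  · subst h₁₃; linarith [keyB hd x₄ x₅ x₆ x₁]
  by_cases h₂₃ : x₂ = x₃
  · subst h₂₃; linarith [keyB hd x₄ x₅ x₆ x₂]
  by_cases h₁₅ : x₁ = x₅
  · subst h₁₅; linarith [keyA (a := b) (b := d) (c := a) (d := c) (by grind) x₂ x₄ x₆]
  by_cases h₁₆ : x₁ = x₆
  · subst h₁₆; linarith [keyA (a := c) (b := d) (c := a) (d := b) (by grind) x₃ x₄ x₅]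
  by_cases h₂₄ : x₂ = x₄
  · subst h₂₄; linarith [keyA (a := a) (b := d) (c := b) (d := c) (by grind) x₁ x₅ x₆]
  by_cases h₂₆ : x₂ = x₆
  · subst h₂₆; linarith [keyA (a := c) (b := d) (c := a) (d := b) (by grind) x₃ x₄ x₅]
  by_cases h₃₄ : x₃ = x₄
  · subst h₃₄; linarith [keyA (a := a) (b := d) (c := b) (d := c) (by grind) x₁ x₅ x₆]
  by_cases h₃₅ : x₃ = x₅
  · subst h₃₅; linarith [keyA (a := b) (b := d) (c := a) (d := c) (by grind) x₂ x₄ x₆]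
  have hbac : [b, a, c, d].Nodup := by grind
  have hcab : [c, a, b, d].Nodup := by grind
  have habc : [a, c, b, d].Nodup := by grind
  have hbca : [b, c, a, d].Nodup := by grind
  by_cases h₁₄ : x₁ = x₄ <;> by_cases h₂₅ : x₂ = x₅ <;> by_cases h₃₆ : x₃ = x₆
  · subst h₁₄ h₂₅ h₃₆
    linarith [h.game_e hd (x₁ := x₁) (x₂ := x₂) (x₃ := x₃) (by grind)]
  · subst h₁₄ h₂₅
    linarith [h.game_f hd (x₁ := x₁) (x₂ := x₂) (x₃ := x₃) (x₄ := x₆) (by grind)]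
  · subst h₁₄ h₃₆
    linarith [h.game_f habc (x₁ := x₁) (x₂ := x₃) (x₃ := x₂) (x₄ := x₅) (by grind)]
  · subst h₁₄
    linarith [h.game_g hd (x₁ := x₁) (x₂ := x₂) (x₃ := x₃) (x₄ := x₅) (x₅ := x₆) (by grind)]
  · subst h₂₅ h₃₆
    linarith [h.game_f hbca (x₁ := x₂) (x₂ := x₃) (x₃ := x₁) (x₄ := x₄) (by grind)]
  · subst h₂₅
    linarith [h.game_g hbac (x₁ := x₂) (x₂ := x₁) (x₃ := x₃) (x₄ := x₄) (x₅ := x₆) (by grind)]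
  · subst h₃₆
    linarith [h.game_g hcab (x₁ := x₃) (x₂ := x₁) (x₃ := x₂) (x₄ := x₄) (x₅ := x₅) (by grind)]
  · exact h.game_h hd (by grind)

theorem mem_signalingPolytope_s2 (h : SatisfiesGames P) (hP : IsChannel P) (hn : 0 < n) :
    P ∈ signalingPolytope n 4 2 := by
  have : Nonempty (Fin n) := ⟨⟨0, hn⟩⟩
  choose X hX using fun y => Finite.exists_max (P y)
  choose Y hY using fun y z => Finite.exists_min fun x => P y x + P z x
  have hd : [(0 : Fin 4), 1, 2, 3].Nodup := by decide
  have keyA := @two_add_one_add_one_le n P h hP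
  have keyC := @triangle_add_one_le n P h hP
  have keyH := @three_singles_add_star_le n P h hP
  obtain ⟨_, _, _, _, _⟩ := hP.bounds hd (X 0)
  obtain ⟨_, _, _, _, _⟩ := hP.bounds hd (X 1)
  obtain ⟨_, _, _, _, _⟩ := hP.bounds hd (X 2)
  obtain ⟨_, _, _, _, _⟩ := hP.bounds hd (X 3)
  obtain ⟨_, _, _, _, _⟩ := hP.bounds hd (Y 0 1)
  obtain ⟨_, _, _, _, _⟩ := hP.bounds hd (Y 0 2)
  obtain ⟨_, _, _, _, _⟩ := hP.bounds hd (Y 0 3)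
  obtain ⟨_, _, _, _, _⟩ := hP.bounds hd (Y 1 2)
  obtain ⟨_, _, _, _, _⟩ := hP.bounds hd (Y 1 3)
  obtain ⟨_, _, _, _, _⟩ := hP.bounds hd (Y 2 3)
  obtain ⟨x₀₁, x₀₂, x₀₃, x₁₂, x₁₃, x₂₃, ⟨n₀₁, n₀₂, n₀₃, n₁₂, n₁₃, n₂₃⟩,
      ⟨c₀₁, c₀₂, c₀₃, c₁₂, c₁₃, c₂₃⟩, ⟨t₀, t₁, t₂, t₃⟩, hsum⟩ :=
    exists_fractional_matching_four
      (t₀ := 1 - P 0 (X 0)) (t₁ := 1 - P 1 (X 1)) (t₂ := 1 - P 2 (X 2)) (t₃ := 1 - P 3 (X 3))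
      (c₀₁ := P 2 (Y 2 3) + P 3 (Y 2 3)) (c₀₂ := P 1 (Y 1 3) + P 3 (Y 1 3))
      (c₀₃ := P 1 (Y 1 2) + P 2 (Y 1 2)) (c₁₂ := P 0 (Y 0 3) + P 3 (Y 0 3))
      (c₁₃ := P 0 (Y 0 2) + P 2 (Y 0 2)) (c₂₃ := P 0 (Y 0 1) + P 1 (Y 0 1))
      (by linarith) (by linarith) (by linarith) (by linarith) (by linarith) (by linarith)
      (by linarith) (by linarith) (by linarith) (by linarith)
      (by linarith [h.six_pairs_le hP hd (Y 2 3) (Y 1 3) (Y 1 2) (Y 0 3) (Y 0 2) (Y 0 1)])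
      (by linarith [keyC (a := 1) (b := 2) (c := 3) (d := 0) (by decide)
            (Y 0 3) (Y 0 2) (Y 0 1) (X 0)])
      (by linarith [keyC (a := 0) (b := 2) (c := 3) (d := 1) (by decide)
            (Y 1 3) (Y 1 2) (Y 0 1) (X 1)])
      (by linarith [keyC (a := 0) (b := 1) (c := 3) (d := 2) (by decide)
            (Y 2 3) (Y 1 2) (Y 0 2) (X 2)])
      (by linarith [keyC (a := 0) (b := 1) (c := 2) (d := 3) (by decide)
            (Y 2 3) (Y 1 3) (Y 0 3) (X 3)])
      (by linarith [keyA (a := 2) (b := 3) (c := 0) (d := 1) (by decide) (Y 0 1) (X 0) (X 1)])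
      (by linarith [keyA (a := 1) (b := 3) (c := 0) (d := 2) (by decide) (Y 0 2) (X 0) (X 2)])
      (by linarith [keyA (a := 1) (b := 2) (c := 0) (d := 3) (by decide) (Y 0 3) (X 0) (X 3)])
      (by linarith [keyA (a := 0) (b := 3) (c := 1) (d := 2) (by decide) (Y 1 2) (X 1) (X 2)])
      (by linarith [keyA (a := 0) (b := 2) (c := 1) (d := 3) (by decide) (Y 1 3) (X 1) (X 3)])
      (by linarith [keyA (a := 0) (b := 1) (c := 2) (d := 3) (by decide) (Y 2 3) (X 2) (X 3)])
      (by linarith [keyA (a := 0) (b := 1) (c := 2) (d := 3) (by decide) (X 1) (X 2) (X 3)])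
      (by linarith [keyA (a := 1) (b := 0) (c := 2) (d := 3) (by decide) (X 0) (X 2) (X 3)])
      (by linarith [keyA (a := 2) (b := 0) (c := 1) (d := 3) (by decide) (X 0) (X 1) (X 3)])
      (by linarith [keyA (a := 3) (b := 0) (c := 1) (d := 2) (by decide) (X 0) (X 1) (X 2)])
      (by linarith [h.four_singles_le hP hd (X 0) (X 1) (X 2) (X 3)])
      (by linarith [keyH (a := 1) (b := 2) (c := 3) (d := 0) (by decide)
            (Y 2 3) (Y 1 3) (Y 1 2) (X 1) (X 2) (X 3)])
      (by linarith [keyH (a := 0) (b := 2) (c := 3) (d := 1) (by decide)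
            (Y 2 3) (Y 0 3) (Y 0 2) (X 0) (X 2) (X 3)])
      (by linarith [keyH (a := 0) (b := 1) (c := 3) (d := 2) (by decide)
            (Y 1 3) (Y 0 3) (Y 0 1) (X 0) (X 1) (X 3)])
      (by linarith [keyH (a := 0) (b := 1) (c := 2) (d := 3) (by decide)
            (Y 1 2) (Y 0 2) (Y 0 1) (X 0) (X 1) (X 2)])
  have hshares : ∀ x, ∃ f₀₁ f₀₂ f₀₃ f₁₂ f₁₃ f₂₃ : ℝ,
      (0 ≤ f₀₁ ∧ 0 ≤ f₀₂ ∧ 0 ≤ f₀₃ ∧ 0 ≤ f₁₂ ∧ 0 ≤ f₁₃ ∧ 0 ≤ f₂₃) ∧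
      (f₀₁ ≤ x₂₃ ∧ f₀₂ ≤ x₁₃ ∧ f₀₃ ≤ x₁₂ ∧ f₁₂ ≤ x₀₃ ∧ f₁₃ ≤ x₀₂ ∧ f₂₃ ≤ x₀₁) ∧
      P 0 x = f₀₁ + f₀₂ + f₀₃ ∧ P 1 x = (x₂₃ - f₀₁) + f₁₂ + f₁₃ ∧
      P 2 x = (x₁₃ - f₀₂) + (x₀₃ - f₁₂) + f₂₃ ∧
      P 3 x = (x₁₂ - f₀₃) + (x₀₂ - f₁₃) + (x₀₁ - f₂₃) := by
    intro x
    obtain ⟨p₀, p₁, p₂, p₃, hp⟩ := hP.bounds hd x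
    apply exists_edge_shares <;> first
      | assumption
      | linarith [hX 0 x, hX 1 x, hX 2 x, hX 3 x]
      | linarith [hY 0 1 x, hY 0 2 x, hY 0 3 x, hY 1 2 x, hY 1 3 x, hY 2 3 x]
  choose f₀₁ f₀₂ f₀₃ f₁₂ f₁₃ f₂₃ hf hfx hf₀ hf₁ hf₂ hf₃ using hshares
  let W : Fin 6 → Matrix (Fin 4) (Fin n) ℝ := ![
    Matrix.of fun y x => ![f₀₁ x, x₂₃ - f₀₁ x, 0, 0] y,
    Matrix.of fun y x => ![f₀₂ x, 0, x₁₃ - f₀₂ x, 0] y,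
    Matrix.of fun y x => ![f₀₃ x, 0, 0, x₁₂ - f₀₃ x] y,
    Matrix.of fun y x => ![0, f₁₂ x, x₀₃ - f₁₂ x, 0] y,
    Matrix.of fun y x => ![0, f₁₃ x, 0, x₀₂ - f₁₃ x] y,
    Matrix.of fun y x => ![0, 0, f₂₃ x, x₀₁ - f₂₃ x] y]
  have hPW : P = ∑ k, W k := by
    ext y x
    fin_cases y <;>
      simp [W, Fin.sum_univ_six, Matrix.add_apply, hf₀ x, hf₁ x, hf₂ x, hf₃ x]
  rw [hPW]
  refine sum_mem_signalingPolytope W ![x₂₃, x₁₃, x₁₂, x₀₃, x₀₂, x₀₁]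
    ![{0, 1}, {0, 2}, {0, 3}, {1, 2}, {1, 3}, {2, 3}] ?_ ?_ ?_ ?_ ?_ ?_
  · decide
  · intro k y x
    obtain ⟨_, _, _, _, _, _⟩ := hf x
    obtain ⟨_, _, _, _, _, _⟩ := hfx x
    fin_cases k <;> fin_cases y <;> simp [W] <;> assumption
  · intro k x
    fin_cases k <;> simp [W, Fin.sum_univ_four]
  · intro k y hy x
    fin_cases k <;> fin_cases y <;> simp [W] at hy ⊢
  · intro k
    fin_cases k <;> assumption
  · simp only [Fin.sum_univ_six]
    simp
    linarith

end SatisfiesGames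

/-- Theorem 2: a channel `P ∈ P^{n→4}` belongs to `C_2^{n→4}` iff it satisfies all
input/output permutations and input liftings of the eight Bell inequalities. -/
theorem mem_signalingPolytope_two_four_iff (n : ℕ) (hn : 0 < n)
    (P : Matrix (Fin 4) (Fin n) ℝ) (hP : IsChannel P) :
    P ∈ signalingPolytope n 4 2 ↔
      ∀ (i : Fin 8) (π : Equiv.Perm (Fin 4)) (σ : Fin 6 → Fin n),
        Set.InjOn σ {j | ∃ y, (thm2Games i).1 y j ≠ 0} →
        ∑ j ∈ Finset.univ.filter (fun j => ∃ y, (thm2Games i).1 y j ≠ 0),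
          ∑ y, (thm2Games i).1 y j * P (π y) (σ j) ≤ (thm2Games i).2 := by
  constructor
  · intro h i π σ _
    rw [sum_nonzero_columns (thm2Games i).1 fun y j => P (π y) (σ j)]
    exact thm2Games_le_of_mem_signalingPolytope h i π σ
  · intro h
    refine SatisfiesGames.mem_signalingPolytope_s2 (fun i π σ hσ => ?_) hP hn
    rw [← sum_nonzero_columns (thm2Games i).1 fun y j => P (π y) (σ j)]
    exact h i π σ hσ
end

section
/- Proposition 1: Let n, n', d, k be positive integers with d ≤ min{n,n'} and k ≤ n'. A channel P ∈ P^{n→n'} belongs to the ambiguous polytope A_{k,d}^{n→n'} if and only if max over all permutations π of [n'] of ( ∑_{i=1}^{k} ‖r_{π(i)}‖_∞ + (1/(n−d+1)) ∑_{i=k+1}^{n'} ‖r_{π(i)}‖_1 ) ≤ d, where r_i denotes the i-th row of P, ‖r_i‖_∞ its largest entry, and ‖r_i‖_1 the sum of its entries. -/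
open Finset

theorem exists_perm_apply_mem_iff {α : Type*} [Fintype α] [DecidableEq α] {S T : Finset α}
    (h : T.card = S.card) : ∃ π : Equiv.Perm α, ∀ a, π a ∈ S ↔ a ∈ T := by
  let e : {a // a ∈ T} ≃ {a // a ∈ S} := Finset.equivOfCardEq h
  exact ⟨e.extendSubtype, fun a =>
    ⟨fun ha => by_contra fun hT => e.extendSubtype_not_mem a hT ha, e.extendSubtype_mem a⟩⟩

theorem card_filter_fin_val_lt {m k : ℕ} (hk : k ≤ m) :
    (univ.filter fun i : Fin m => (i : ℕ) < k).card = k := by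
  simp [Fin.card_filter_val_lt, hk]

theorem bip_eq_sum_rows {n m : ℕ} (G P : Matrix (Fin m) (Fin n) ℝ) :
    bip G P = ∑ y, ∑ x, G y x * P y x :=
  Finset.sum_comm

/-- Proposition 1: membership in the ambiguous polytope is characterized by the
maximal ambiguous guessing game score over all permutations of the rows of `P`:
rows `π(1), …, π(k)` contribute their largest entry, the remaining rows contribute
`1/(n-d+1)` times their row sum. -/
theorem mem_ambiguousPolytope_iff (n n' k d : ℕ)
    (hn : 0 < n) (hn' : 0 < n') (hk : 0 < k) (hd : 0 < d)
    (hdm : d ≤ min n n') (hkn : k ≤ n')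
    (P : Matrix (Fin n') (Fin n) ℝ) (hP : IsChannel P) :
    P ∈ ambiguousPolytope n n' k d ↔
      ∀ π : Equiv.Perm (Fin n'),
        ∑ i : Fin n',
          (if (i : ℕ) < k then ⨆ x, P (π i) x
           else (1 / ((n : ℝ) - (d : ℝ) + 1)) * ∑ x, P (π i) x) ≤ (d : ℝ) := by
  set c : ℝ := 1 / ((n : ℝ) - (d : ℝ) + 1) with hc
  constructor
  · rintro ⟨-, hG⟩ π
    have : Nonempty (Fin n) := ⟨⟨0, hn⟩⟩
    choose x₀ hx₀ using fun y => exists_eq_ciSup_of_finite (f := P y)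
    let G : Matrix (Fin n') (Fin n) ℝ := fun y x =>
      if ((π.symm y : Fin n') : ℕ) < k then (if x = x₀ y then 1 else 0) else c
    have hgame : IsAmbiguousGame n n' k d G := by
      refine ⟨(univ.filter fun i : Fin n' => (i : ℕ) < k).map π.toEmbedding, ?_, ?_, ?_⟩
      · rw [card_map, card_filter_fin_val_lt hkn]
      · intro y hy
        obtain ⟨i, hi, rfl⟩ := mem_map.1 hy
        have hi : (i : ℕ) < k := (mem_filter.1 hi).2
        exact ⟨x₀ (π i), by simp [G, hi], fun x hx => by simp [G, hi, hx]⟩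
      · intro y hy x
        have hlt : ¬ ((π.symm y : Fin n') : ℕ) < k := fun h =>
          hy (mem_map.2 ⟨π.symm y, by simp [h], by simp⟩)
        simp [G, hlt, hc]
    refine le_of_eq_of_le ?_ (hG G hgame)
    rw [bip_eq_sum_rows, ← Equiv.sum_comp π fun y => ∑ x, G y x * P y x]
    refine sum_congr rfl fun i _ => ?_
    by_cases hi : (i : ℕ) < k
    · simp [G, hi, hx₀]
    · simp [G, hi, mul_sum]
  · refine fun hπ => ⟨hP, ?_⟩
    rintro G ⟨S, hS, hguess, hamb⟩
    obtain ⟨π, hmem⟩ := exists_perm_apply_mem_iff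
      (T := univ.filter fun i : Fin n' => (i : ℕ) < k) ((card_filter_fin_val_lt hkn).trans hS.symm)
    refine le_trans ?_ (hπ π)
    rw [bip_eq_sum_rows, ← Equiv.sum_comp π]
    refine sum_le_sum fun i _ => ?_
    have hi_iff : π i ∈ S ↔ (i : ℕ) < k := by simp [hmem]
    split_ifs with hi
    · obtain ⟨x₀, h1, h0⟩ := hguess _ (hi_iff.2 hi)
      rw [sum_eq_single x₀ (fun x _ hx => by rw [h0 x hx, zero_mul]) (by simp), h1, one_mul]
      exact le_ciSup (Set.finite_range _).bddAbove x₀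
    · rw [mul_sum]
      exact (sum_congr rfl fun x _ => by rw [hamb _ (mt hi_iff.1 hi) x]).le
end

section
/- Ambiguous guessing Bell inequality (Eq. (8)): Let n, n', d, k be positive integers with 1 ≤ d ≤ min{n,n'} and 0 ≤ k ≤ n'. For every ambiguous guessing game matrix G^{n,n'}_{k,d} and every channel P ∈ C_d^{n→n'}, one has ⟨G^{n,n'}_{k,d}, P⟩ ≤ d. -/
open Finset

/-- A guessing row scores at most one against any channel. -/
theorem sum_guessingRow_le_one {n n' : ℕ} {G V : Matrix (Fin n') (Fin n) ℝ} (hV : IsChannel V)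
    {y : Fin n'} (hy : ∃ x₀, G y x₀ = 1 ∧ ∀ x, x ≠ x₀ → G y x = 0) :
    ∑ x, G y x * V y x ≤ 1 := by
  obtain ⟨x₀, h₁, h₀⟩ := hy
  rw [Finset.sum_eq_single x₀ (fun x _ hx => by rw [h₀ x hx, zero_mul]) (by simp), h₁, one_mul,
    ← hV.2 x₀]
  exact Finset.single_le_sum (f := fun y => V y x₀) (fun y _ => hV.1 y x₀) (Finset.mem_univ y)

/-- The ambiguous guessing game inequality at a vertex of the signaling polytope. -/
theorem IsVertex.bip_le {n n' k d : ℕ} (hdn : d ≤ n) {G V : Matrix (Fin n') (Fin n) ℝ}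
    (hG : IsAmbiguousGame n n' k d G) (hV : IsVertex d V) : bip G V ≤ d := by
  classical
  obtain ⟨S, -, hS, hamb⟩ := hG
  obtain ⟨hch, h01, hcard⟩ := hV
  set R : Finset (Fin n') := {y | ∃ x, V y x ≠ 0} with hR
  have hRcard : R.card ≤ d := by
    rw [← Set.ncard_coe_finset]
    simpa [hR] using hcard
  have hzero : ∀ y ∉ R, ∀ x, V y x = 0 := by
    intro y hy x
    by_contra h
    exact hy (by simpa [hR] using ⟨x, h⟩)
  have hbip : bip G V = ∑ y ∈ R, ∑ x, G y x * V y x := by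
    rw [bip, Finset.sum_comm]
    exact (Finset.sum_subset (Finset.subset_univ R) fun y _ hy =>
      Finset.sum_eq_zero fun x _ => by rw [hzero y hy x, mul_zero]).symm
  rw [hbip]
  by_cases hRS : R ⊆ S
  · calc ∑ y ∈ R, ∑ x, G y x * V y x ≤ ∑ _y ∈ R, (1 : ℝ) :=
          Finset.sum_le_sum fun y hy => sum_guessingRow_le_one hch (hS y (hRS hy))
      _ = (R.card : ℝ) := by simp
      _ ≤ d := by exact_mod_cast hRcard
  · set c : ℝ := 1 / ((n : ℝ) - d + 1) with hc
    have hdn' : (d : ℝ) ≤ n := by exact_mod_cast hdn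
    have hpos : (0 : ℝ) < (n : ℝ) - d + 1 := by linarith
    have hc0 : 0 ≤ c := by positivity
    have hc1 : c ≤ 1 := by rw [hc, div_le_one hpos]; linarith
    have hcmul : c * ((n : ℝ) - d + 1) = 1 := one_div_mul_cancel hpos.ne'
    have hrow : ∀ y ∈ R, ∑ x, G y x * V y x ≤ (if y ∈ S then 1 - c else 0) + c * ∑ x, V y x := by
      intro y hy
      split_ifs with hyS
      · obtain ⟨x, hx⟩ : ∃ x, V y x ≠ 0 := by simpa [hR] using hy
        have hsum : 1 ≤ ∑ x, V y x := by
          rw [← (h01 y x).resolve_left hx]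
          exact Finset.single_le_sum (f := fun x => V y x) (fun x _ => hch.1 y x)
            (Finset.mem_univ x)
        nlinarith [sum_guessingRow_le_one hch (hS y hyS), mul_le_mul_of_nonneg_left hsum hc0]
      · simp [hamb y hyS, hc, Finset.mul_sum]
    have htotal : ∑ y ∈ R, ∑ x, V y x = n := by
      calc ∑ y ∈ R, ∑ x, V y x = ∑ y, ∑ x, V y x :=
            Finset.sum_subset (Finset.subset_univ R) fun y _ hy =>
              Finset.sum_eq_zero fun x _ => hzero y hy x
        _ = ∑ x, ∑ y, V y x := Finset.sum_comm
        _ = n := by simp [hch.2]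
    have hguess : ((R.filter (· ∈ S)).card : ℝ) + 1 ≤ d := by
      have hlt : (R.filter (· ∈ S)).card < R.card := by
        obtain ⟨y, hy, hyS⟩ := Finset.not_subset.mp hRS
        exact Finset.card_lt_card (Finset.filter_ssubset.mpr ⟨y, hy, hyS⟩)
      exact_mod_cast hlt.trans_le hRcard
    have hle := Finset.sum_le_sum hrow
    rw [Finset.sum_add_distrib, ← Finset.mul_sum, htotal, ← Finset.sum_filter, Finset.sum_const,
      nsmul_eq_mul] at hle
    nlinarith [mul_le_mul_of_nonneg_right hguess (sub_nonneg.mpr hc1)]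

/-- The Bell functional `⟨G, ·⟩` is linear. -/
theorem isLinearMap_bip {n n' : ℕ} (G : Matrix (Fin n') (Fin n) ℝ) : IsLinearMap ℝ (bip G) where
  map_add P Q := by simp [bip, mul_add, Finset.sum_add_distrib]
  map_smul a P := by simp [bip, Finset.mul_sum, mul_left_comm]

/-- Eq. (8): every ambiguous guessing game Bell inequality `⟨G^{n,n'}_{k,d}, P⟩ ≤ d`
holds on the signaling polytope `C_d^{n → n'}`. -/
theorem ambiguousGame_bell_inequality (n n' k d : ℕ)
    (hn : 0 < n) (hn' : 0 < n') (hd : 1 ≤ d) (hdm : d ≤ min n n') (hkn : k ≤ n')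
    (G : Matrix (Fin n') (Fin n) ℝ) (hG : IsAmbiguousGame n n' k d G)
    (P : Matrix (Fin n') (Fin n) ℝ) (hPmem : P ∈ signalingPolytope n n' d) :
    bip G P ≤ (d : ℝ) := by
  exact convexHull_min (fun _ hV => hV.bip_le (hdm.trans (min_le_left n n')) hG)
    (convex_halfSpace_le (isLinearMap_bip G) (d : ℝ)) hPmem
end

section
/- Proposition 2(ii) (rank form): Let n, n', d, k be positive integers with n' > k ≥ n > d > 1, and let G be an n'×n ambiguous guessing game matrix with k guessing rows (0/1 rows with exactly one 1) and n'−k ambiguous rows (all entries equal to 1/(n−d+1)). Then (G, d) is a tight Bell inequality (facet) of C_d^{n→n'} if and only if the k×n submatrix formed by the guessing rows has rank n. -/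
open Finset

/-- `(G, γ)` is a tight Bell inequality (facet) of `C_d^{n → n'}`: it is valid on the
signaling polytope and is saturated by `n (n' - 1)` affinely independent vertices. -/
def IsTightBell (n n' d : ℕ) (G : Matrix (Fin n') (Fin n) ℝ) (γ : ℝ) : Prop :=
  (∀ P ∈ signalingPolytope n n' d, bip G P ≤ γ) ∧
  ∃ V : Fin (n * (n' - 1)) → Matrix (Fin n') (Fin n) ℝ,
    AffineIndependent ℝ V ∧ ∀ i, IsVertex d (V i) ∧ bip G (V i) = γ

/-- The deterministic channel `P(y|x) = [f x = y]`. -/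
def deterministicChannel {n n' : ℕ} (f : Fin n → Fin n') : Matrix (Fin n') (Fin n) ℝ :=
  fun y x => if f x = y then 1 else 0

theorem bip_deterministicChannel {n n' : ℕ} (H : Matrix (Fin n') (Fin n) ℝ)
    (f : Fin n → Fin n') : bip H (deterministicChannel f) = ∑ x, H (f x) x := by
  simp [bip, deterministicChannel]

theorem isVertex_deterministicChannel {n n' d : ℕ} {f : Fin n → Fin n'}
    (hf : (univ.image f).card ≤ d) : IsVertex d (deterministicChannel f) := by
  refine ⟨⟨fun y x => ?_, fun x => ?_⟩, fun y x => ?_, ?_⟩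
  · unfold deterministicChannel; split_ifs <;> norm_num
  · simp [deterministicChannel]
  · unfold deterministicChannel; split_ifs <;> simp
  · have : {y : Fin n' | ∃ x, deterministicChannel f y x ≠ 0} = ↑(univ.image f) := by
      ext y; simp [deterministicChannel]
    rwa [this, Set.ncard_coe_finset]

theorem IsVertex.exists_eq_deterministicChannel {n n' d : ℕ} {V : Matrix (Fin n') (Fin n) ℝ}
    (hV : IsVertex d V) :
    ∃ f : Fin n → Fin n', V = deterministicChannel f ∧ (univ.image f).card ≤ d := by
  obtain ⟨⟨hnn, hsum⟩, h01, hcard⟩ := hV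
  have hone : ∀ x, ∃ y, V y x = 1 := by
    intro x
    by_contra! h
    have hz : ∑ y, V y x = 0 :=
      Finset.sum_eq_zero fun y _ => (h01 y x).resolve_right (h y)
    rw [hsum x] at hz
    exact one_ne_zero hz
  choose f hf using hone
  have hVf : V = deterministicChannel f := by
    ext y x
    unfold deterministicChannel
    split_ifs with h
    · rw [← h, hf]
    · refine (h01 y x).resolve_right fun h1 => ?_
      have hle : ∑ z ∈ {f x, y}, V z x ≤ ∑ z, V z x :=
        Finset.sum_le_sum_of_subset_of_nonneg (Finset.subset_univ _) fun z _ _ => hnn z x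
      rw [Finset.sum_pair h, hsum, hf, h1] at hle
      norm_num at hle
  refine ⟨f, hVf, ?_⟩
  have : {y : Fin n' | ∃ x, V y x ≠ 0} = ↑(univ.image f) := by
    ext y; simp [hVf, deterministicChannel]
  rwa [this, Set.ncard_coe_finset] at hcard

/-- The pairing with a fixed Bell functional, as a linear map in both arguments. -/
def bipLinear (n n' : ℕ) :
    Matrix (Fin n') (Fin n) ℝ →ₗ[ℝ] Module.Dual ℝ (Matrix (Fin n') (Fin n) ℝ) :=
  LinearMap.mk₂ ℝ bip
    (fun _ _ _ => by simp [bip, add_mul, Finset.sum_add_distrib])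
    (fun _ _ _ => by simp [bip, Finset.mul_sum, mul_assoc])
    (fun _ _ _ => by simp [bip, mul_add, Finset.sum_add_distrib])
    (fun _ _ _ => by simp [bip, Finset.mul_sum, mul_left_comm])

@[simp] theorem bipLinear_apply {n n' : ℕ} (H P : Matrix (Fin n') (Fin n) ℝ) :
    bipLinear n n' H P = bip H P := rfl

theorem bip_single {n n' : ℕ} (H : Matrix (Fin n') (Fin n) ℝ) (y : Fin n') (x : Fin n) :
    bip H (Matrix.single y x 1) = H y x := by
  unfold bip
  rw [Finset.sum_eq_single x, Finset.sum_eq_single y] <;>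
    simp +contextual [Matrix.single_apply, eq_comm]

theorem bipLinear_injective (n n' : ℕ) : Function.Injective (bipLinear n n') := by
  intro H H' h
  ext y x
  rw [← bip_single H, ← bip_single H', ← bipLinear_apply, h, bipLinear_apply]

theorem bipLinear_surjective (n n' : ℕ) : Function.Surjective (bipLinear n n') :=
  (LinearMap.injective_iff_surjective_of_finrank_eq_finrank
    (Subspace.dual_finrank_eq).symm).1 (bipLinear_injective n n')

theorem bip_le_of_mem_signalingPolytope {n n' d : ℕ} {G : Matrix (Fin n') (Fin n) ℝ} {γ : ℝ}
    (h : ∀ V, IsVertex d V → bip G V ≤ γ) {P : Matrix (Fin n') (Fin n) ℝ}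
    (hP : P ∈ signalingPolytope n n' d) : bip G P ≤ γ :=
  convexHull_min (s := {V | IsVertex d V}) (t := {P | bipLinear n n' G P ≤ γ})
    (fun V hV => h V hV) (convex_halfSpace_le (bipLinear n n' G).isLinear γ) hP

/-- The Bell functionals vanishing on a set `s` of channels. -/
def vanishingFunctionals {n n' : ℕ} (s : Set (Matrix (Fin n') (Fin n) ℝ)) :
    Submodule ℝ (Matrix (Fin n') (Fin n) ℝ) :=
  (Submodule.span ℝ s).dualAnnihilator.comap (bipLinear n n')

theorem mem_vanishingFunctionals {n n' : ℕ} {s : Set (Matrix (Fin n') (Fin n) ℝ)}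
    {H : Matrix (Fin n') (Fin n) ℝ} :
    H ∈ vanishingFunctionals s ↔ ∀ V ∈ s, bip H V = 0 := by
  rw [vanishingFunctionals, Submodule.mem_comap, Submodule.mem_dualAnnihilator]
  refine ⟨fun h V hV => h V (Submodule.subset_span hV), fun h V hV => ?_⟩
  have hle : Submodule.span ℝ s ≤ LinearMap.ker (bipLinear n n' H) :=
    Submodule.span_le.2 fun V hV => h V hV
  exact hle hV

theorem finrank_span_add_finrank_vanishingFunctionals {n n' : ℕ}
    (s : Set (Matrix (Fin n') (Fin n) ℝ)) :
    Module.finrank ℝ (Submodule.span ℝ s) +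
      Module.finrank ℝ (vanishingFunctionals s) = n' * n := by
  have h := Subspace.finrank_add_finrank_dualAnnihilator_eq (Submodule.span ℝ s)
  rw [Module.finrank_matrix] at h
  let e := LinearEquiv.ofBijective (bipLinear n n')
    ⟨bipLinear_injective n n', bipLinear_surjective n n'⟩
  have he : vanishingFunctionals s = (Submodule.span ℝ s).dualAnnihilator.map
      (e.symm : Module.Dual ℝ (Matrix (Fin n') (Fin n) ℝ) →ₗ[ℝ] _) :=
    Submodule.comap_equiv_eq_map_symm e _
  rw [he, LinearEquiv.finrank_map_eq, h]
  simp

/-- The vertices of the signaling polytope saturating a Bell inequality. -/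
def saturatingVertices {n n' : ℕ} (d : ℕ) (G : Matrix (Fin n') (Fin n) ℝ) (γ : ℝ) :
    Set (Matrix (Fin n') (Fin n) ℝ) :=
  {V | IsVertex d V ∧ bip G V = γ}

theorem AffineIndependent.linearIndependent_of_eq_const {ι E : Type*} [AddCommGroup E]
    [Module ℝ E] {v : ι → E} (hv : AffineIndependent ℝ v) {φ : Module.Dual ℝ E} {γ : ℝ}
    (hγ : γ ≠ 0) (h : ∀ i, φ (v i) = γ) : LinearIndependent ℝ v := by
  rw [linearIndependent_iff']
  intro s w hw
  refine affineIndependent_iff.1 hv s w ?_ hw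
  have := congrArg φ hw
  simpa [h, ← Finset.sum_mul, hγ] using this

theorem isTightBell_iff {n n' d : ℕ} (hn' : 0 < n') {G : Matrix (Fin n') (Fin n) ℝ} {γ : ℝ}
    (hγ : γ ≠ 0) :
    IsTightBell n n' d G γ ↔ (∀ V, IsVertex d V → bip G V ≤ γ) ∧
      Module.finrank ℝ (vanishingFunctionals (saturatingVertices d G γ)) ≤ n := by
  have hrank := finrank_span_add_finrank_vanishingFunctionals (saturatingVertices d G γ)
  have hmul : n * (n' - 1) + n = n' * n := by
    obtain ⟨m, rfl⟩ := Nat.exists_eq_add_of_lt hn'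
    simp; ring
  constructor
  · rintro ⟨hvalid, V, hV, hsat⟩
    refine ⟨fun V hV => hvalid V (subset_convexHull ℝ _ hV), ?_⟩
    have hlin : LinearIndependent ℝ V :=
      hV.linearIndependent_of_eq_const (φ := bipLinear n n' G) hγ fun i => (hsat i).2
    have hcard := finrank_span_eq_card hlin
    have hle := Submodule.finrank_mono (R := ℝ) (Submodule.span_mono (R := ℝ)
      (Set.range_subset_iff.2 hsat : Set.range V ⊆ saturatingVertices d G γ))
    rw [hcard, Fintype.card_fin] at hle
    omega
  · rintro ⟨hvalid, hvan⟩
    refine ⟨fun P hP => bip_le_of_mem_signalingPolytope hvalid hP, ?_⟩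
    obtain ⟨v, hv, -, hlin⟩ :=
      Submodule.exists_fun_fin_finrank_span_eq ℝ (saturatingVertices d G γ)
    have hle : n * (n' - 1) ≤
        Module.finrank ℝ (Submodule.span ℝ (saturatingVertices d G γ)) := by omega
    exact ⟨v ∘ Fin.castLE hle,
      (hlin.comp _ (Fin.castLE_injective hle)).affineIndependent ℝ, fun i => hv _⟩

theorem eq_of_forall_sum_card_eq {n m : ℕ} (hm : 0 < m) (hmn : m < n) {φ : Fin n → ℝ} {K : ℝ}
    (h : ∀ T : Finset (Fin n), T.card = m → ∑ t ∈ T, φ t = K) (x : Fin n) : m * φ x = K := by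
  have hconst : ∀ x', φ x' = φ x := by
    intro x'
    by_cases hx : x' = x
    · rw [hx]
    obtain ⟨T, hxT, hT, hcard⟩ := Finset.exists_subsuperset_card_eq
      (s := {x}) (t := univ.erase x') (n := m) (by simp [Ne.symm hx]) (by simpa using Nat.succ_le_of_lt hm)
      (by simp; omega)
    have hxT : x ∈ T := by simpa using hxT
    have hx'T : x' ∉ T := fun h' => by simpa using hT h'
    have h1 := h T hcard
    have h2 := h (insert x' (T.erase x)) (by
      rw [Finset.card_insert_of_notMem (by simp [hx'T]), Finset.card_erase_of_mem hxT]
      omega)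
    rw [Finset.sum_insert (by simp [hx'T])] at h2
    rw [← Finset.add_sum_erase T φ hxT] at h1
    linarith
  obtain ⟨T, -, hT⟩ := Finset.exists_subset_card_eq (s := (univ : Finset (Fin n))) (n := m)
    (by simp; omega)
  rw [← h T hT, Finset.sum_congr rfl fun t _ => hconst t]
  simp [hT]

/-- The ambiguous guessing game: a row `y ∈ S` guesses the input `g y`, and the other rows are
ambiguous. -/
noncomputable def ambiguousGame {n n' : ℕ} (S : Finset (Fin n')) (g : Fin n' → Fin n) (d : ℕ) :
    Matrix (Fin n') (Fin n) ℝ :=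
  fun y x => if y ∈ S then if g y = x then 1 else 0 else 1 / ((n : ℝ) - d + 1)

section Game

variable {n n' d : ℕ} {S : Finset (Fin n')} {g : Fin n' → Fin n}

/-- The inputs that the strategy `f` guesses correctly. -/
def correctInputs (S : Finset (Fin n')) (g : Fin n' → Fin n) (f : Fin n → Fin n') :
    Finset (Fin n) :=
  univ.filter fun x => f x ∈ S ∧ g (f x) = x

/-- The inputs that the strategy `f` sends to an ambiguous row. -/
def ambiguousInputs (S : Finset (Fin n')) (f : Fin n → Fin n') : Finset (Fin n) :=
  univ.filter fun x => f x ∉ S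

theorem sum_ambiguousGame (f : Fin n → Fin n') :
    ∑ x, ambiguousGame S g d (f x) x =
      (correctInputs S g f).card + (ambiguousInputs S f).card / ((n : ℝ) - d + 1) := by
  have h : ∀ x, ambiguousGame S g d (f x) x = (if f x ∈ S ∧ g (f x) = x then (1 : ℝ) else 0) +
      (if f x ∉ S then (1 : ℝ) else 0) / ((n : ℝ) - d + 1) := by
    intro x
    by_cases hx : f x ∈ S <;> simp [ambiguousGame, hx]
  rw [Finset.sum_congr rfl fun x _ => h x, Finset.sum_add_distrib, ← Finset.sum_div,
    Finset.sum_boole, Finset.sum_boole]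
  rfl

theorem disjoint_correctInputs_ambiguousInputs (f : Fin n → Fin n') :
    Disjoint (correctInputs S g f) (ambiguousInputs S f) := by
  rw [Finset.disjoint_left]
  intro x hx hx'
  exact (Finset.mem_filter.1 hx').2 (Finset.mem_filter.1 hx).2.1

theorem card_correctInputs_add_card_ambiguousInputs_le (f : Fin n → Fin n') :
    (correctInputs S g f).card + (ambiguousInputs S f).card ≤ n := by
  rw [← Finset.card_union_of_disjoint (disjoint_correctInputs_ambiguousInputs f)]
  exact (Finset.card_le_univ _).trans_eq (Fintype.card_fin n)

theorem card_correctInputs_add_card_image_le (f : Fin n → Fin n') :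
    (correctInputs S g f).card + ((ambiguousInputs S f).image f).card ≤
      (univ.image f).card := by
  have hinj : Set.InjOn f (correctInputs S g f) := by
    intro x hx x' hx' h
    simp only [correctInputs, Finset.coe_filter, Set.mem_ofPred_eq, Finset.mem_univ,
      true_and] at hx hx'
    rw [← hx.2, ← hx'.2, h]
  rw [← Finset.card_image_of_injOn hinj, ← Finset.card_union_of_disjoint]
  · exact Finset.card_le_card (Finset.union_subset (Finset.image_subset_image
      (Finset.subset_univ _)) (Finset.image_subset_image (Finset.subset_univ _)))
  · rw [Finset.disjoint_left]
    simp only [correctInputs, ambiguousInputs, Finset.mem_image, Finset.mem_filter]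
    rintro _ ⟨x, ⟨-, hx, -⟩, rfl⟩ ⟨x', ⟨-, hx'⟩, h⟩
    exact hx' (h ▸ hx)

theorem sum_ambiguousGame_le (hdn : d < n) {f : Fin n → Fin n'}
    (hf : (univ.image f).card ≤ d) : ∑ x, ambiguousGame S g d (f x) x ≤ d := by
  rw [sum_ambiguousGame]
  have h1 := card_correctInputs_add_card_ambiguousInputs_le (S := S) (g := g) f
  have h2 := (card_correctInputs_add_card_image_le (S := S) (g := g) f).trans hf
  have hdn' : (d : ℝ) + 1 ≤ n := by exact_mod_cast hdn
  rcases (ambiguousInputs S f).eq_empty_or_nonempty with h | h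
  · rw [h] at h2 ⊢
    simpa using h2
  · have h3 := (h.image f).card_pos
    have h4 : ((correctInputs S g f).card : ℝ) + 1 ≤ d := by exact_mod_cast (by omega)
    have h1' : ((correctInputs S g f).card : ℝ) + (ambiguousInputs S f).card ≤ n := by
      exact_mod_cast h1
    rw [← le_sub_iff_add_le', div_le_iff₀ (by linarith)]
    nlinarith

theorem card_correctInputs_of_sum_eq (hdn : d < n) {f : Fin n → Fin n'}
    (hf : (univ.image f).card ≤ d) (hsum : ∑ x, ambiguousGame S g d (f x) x = d)
    (h : (ambiguousInputs S f).Nonempty) :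
    (correctInputs S g f).card + 1 = d ∧ (ambiguousInputs S f).card + d = n + 1 := by
  rw [sum_ambiguousGame] at hsum
  have h1 := card_correctInputs_add_card_ambiguousInputs_le (S := S) (g := g) f
  have h2 := (card_correctInputs_add_card_image_le (S := S) (g := g) f).trans hf
  have hdn' : (d : ℝ) + 1 ≤ n := by exact_mod_cast hdn
  have h3 := (h.image f).card_pos
  have h4 : ((correctInputs S g f).card : ℝ) + 1 ≤ d := by exact_mod_cast (by omega)
  have h1' : ((correctInputs S g f).card : ℝ) + (ambiguousInputs S f).card ≤ n := by
    exact_mod_cast h1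
  rw [← eq_sub_iff_add_eq', div_eq_iff (by linarith)] at hsum
  have h5 : ((correctInputs S g f).card : ℝ) + 1 = d := by
    refine le_antisymm h4 ?_
    nlinarith
  have h6 : ((ambiguousInputs S f).card : ℝ) + d = n + 1 := by
    rw [hsum, ← h5]; ring
  exact ⟨by exact_mod_cast h5, by exact_mod_cast h6⟩

theorem card_fiber_of_sum_eq (hdn : d < n) {f : Fin n → Fin n'}
    (hf : (univ.image f).card ≤ d) (hsum : ∑ x, ambiguousGame S g d (f x) x = d)
    {x₀ : Fin n} (hx₀ : ∀ y ∈ S, g y ≠ x₀) {a : Fin n'} (ha : a ∉ S) :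
    ((univ.filter fun x => f x = a).card : ℝ) = ((n : ℝ) - d + 1) * if f x₀ = a then 1 else 0 := by
  rcases (ambiguousInputs S f).eq_empty_or_nonempty with h | h
  · have hS : ∀ x, f x ≠ a := by
      intro x hx
      have : x ∈ ambiguousInputs S f := by simpa [ambiguousInputs, hx] using ha
      simp [h] at this
    simp [hS]
  obtain ⟨hc, hm⟩ := card_correctInputs_of_sum_eq hdn hf hsum h
  have hunion : correctInputs S g f ∪ ambiguousInputs S f = univ := by
    rw [← Finset.card_eq_iff_eq_univ,
      Finset.card_union_of_disjoint (disjoint_correctInputs_ambiguousInputs f), Fintype.card_fin]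
    omega
  have hx₀m : x₀ ∈ ambiguousInputs S f := by
    have := Finset.mem_univ x₀
    rw [← hunion, Finset.mem_union] at this
    refine this.resolve_left fun h' => ?_
    obtain ⟨-, h1, h2⟩ := Finset.mem_filter.1 h'
    exact hx₀ _ h1 h2
  have hconst : ∀ x ∈ ambiguousInputs S f, f x = f x₀ := by
    have hcard := (card_correctInputs_add_card_image_le (S := S) (g := g) f).trans hf
    intro x hx
    exact Finset.card_le_one.1 (show ((ambiguousInputs S f).image f).card ≤ 1 by omega) _
      (Finset.mem_image_of_mem f hx) _ (Finset.mem_image_of_mem f hx₀m)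
  have hmem : ∀ x, f x = a → x ∈ ambiguousInputs S f := fun x hx => by
    simpa [ambiguousInputs, hx] using ha
  split_ifs with h₀
  · have : (univ.filter fun x => f x = a) = ambiguousInputs S f := by
      ext x
      simp only [Finset.mem_filter, Finset.mem_univ, true_and]
      exact ⟨hmem x, fun hx => (hconst x hx).trans h₀⟩
    rw [this, mul_one]
    have hm' : ((ambiguousInputs S f).card : ℝ) + d = n + 1 := by exact_mod_cast hm
    linarith
  · have : ∀ x, f x ≠ a := fun x hx => h₀ ((hconst x (hmem x hx)).symm.trans hx)
    simp [this]

/-- The saturated functionals that come from column-stochasticity and the game itself. -/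
noncomputable def trivialFunctionals (G : Matrix (Fin n') (Fin n) ℝ) (γ : ℝ) :
    (Fin n → ℝ) →ₗ[ℝ] Matrix (Fin n') (Fin n) ℝ where
  toFun c := Matrix.of fun y x => c x - (∑ z, c z) / γ * G y x
  map_add' c c' := by
    ext y x
    simp [Finset.sum_add_distrib]
    ring
  map_smul' r c := by
    ext y x
    simp [← Finset.mul_sum]
    ring

theorem trivialFunctionals_apply (G : Matrix (Fin n') (Fin n) ℝ) (γ : ℝ) (c : Fin n → ℝ)
    (y : Fin n') (x : Fin n) :
    trivialFunctionals G γ c y x = c x - (∑ z, c z) / γ * G y x := rfl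

theorem mem_vanishingFunctionals_saturatingVertices {G H : Matrix (Fin n') (Fin n) ℝ} {γ : ℝ} :
    H ∈ vanishingFunctionals (saturatingVertices d G γ) ↔
      ∀ f : Fin n → Fin n', (univ.image f).card ≤ d → ∑ x, G (f x) x = γ →
        ∑ x, H (f x) x = 0 := by
  rw [mem_vanishingFunctionals]
  constructor
  · intro h f hf hsum
    rw [← bip_deterministicChannel]
    exact h _ ⟨isVertex_deterministicChannel hf, by rw [bip_deterministicChannel, hsum]⟩
  · rintro h V ⟨hV, hsum⟩
    obtain ⟨f, rfl, hf⟩ := hV.exists_eq_deterministicChannel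
    rw [bip_deterministicChannel] at hsum ⊢
    exact h f hf hsum

theorem range_trivialFunctionals_le {G : Matrix (Fin n') (Fin n) ℝ} {γ : ℝ} (hγ : γ ≠ 0) :
    LinearMap.range (trivialFunctionals G γ) ≤
      vanishingFunctionals (saturatingVertices d G γ) := by
  rintro _ ⟨c, rfl⟩
  rw [mem_vanishingFunctionals_saturatingVertices]
  intro f _ hsum
  simp only [trivialFunctionals_apply, Finset.sum_sub_distrib, ← Finset.mul_sum, hsum]
  field_simp
  ring

/-- If no row guesses `x₀`, the face has codimension at least two. -/
theorem exists_guess_of_finrank_le (hd : 1 < d) (hdn : d < n) (hS : S.Nonempty)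
    {a : Fin n'} (ha : a ∉ S)
    (h : Module.finrank ℝ (vanishingFunctionals
      (saturatingVertices d (ambiguousGame S g d) (d : ℝ))) ≤ n) (x₀ : Fin n) :
    ∃ y ∈ S, g y = x₀ := by
  by_contra! hx₀
  have hd0 : (d : ℝ) ≠ 0 := by positivity
  have hdn' : (d : ℝ) + 1 ≤ n := by exact_mod_cast hdn
  have hm : (n : ℝ) - d + 1 ≠ 0 := by linarith
  obtain ⟨y, hy⟩ := hS
  have hgy := hx₀ y hy
  have hinj : Function.Injective (trivialFunctionals (ambiguousGame S g d) (d : ℝ)) := by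
    rw [injective_iff_map_eq_zero]
    intro c hc
    have happ : ∀ y x, c x - (∑ z, c z) / d * ambiguousGame S g d y x = 0 := fun y x =>
      congrFun (congrFun hc y) x
    have h1 : c x₀ = 0 := by simpa [ambiguousGame, hy, hgy] using happ y x₀
    have h2 : (∑ z, c z) / d = 0 := by
      simpa [ambiguousGame, ha, h1, hm, hd0] using happ a x₀
    ext x
    simpa [h2] using happ y x
  have hrange := Submodule.eq_of_le_of_finrank_le
    (range_trivialFunctionals_le (d := d) (G := ambiguousGame S g d) hd0)
    (by rw [LinearMap.finrank_range_of_inj hinj]; simpa using h)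
  let H : Matrix (Fin n') (Fin n) ℝ := fun y x =>
    if y = a then 1 - (if x = x₀ then (n : ℝ) - d + 1 else 0) else 0
  have hH : H ∈ vanishingFunctionals
      (saturatingVertices d (ambiguousGame S g d) (d : ℝ)) := by
    rw [mem_vanishingFunctionals_saturatingVertices]
    intro f hf hsum
    have hcard := card_fiber_of_sum_eq hdn hf hsum hx₀ ha
    have hsplit : ∀ x, H (f x) x = (if f x = a then 1 else 0) -
        if x = x₀ then ((n : ℝ) - d + 1) * (if f x₀ = a then 1 else 0) else 0 := by
      intro x
      by_cases h1 : f x = a <;> by_cases h2 : x = x₀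
      · subst h2; simp [H, h1]
      · simp [H, h1, h2]
      · subst h2; simp [H, h1]
      · simp [H, h1, h2]
    rw [Finset.sum_congr rfl fun x _ => hsplit x, Finset.sum_sub_distrib, Finset.sum_boole,
      hcard, Finset.sum_ite_eq' univ x₀]
    simp
  rw [← hrange] at hH
  obtain ⟨c, hc⟩ := hH
  obtain ⟨x, hx⟩ : ∃ x, x ∉ ({x₀, g y} : Finset (Fin n)) := by
    by_contra! hall
    have := (Finset.card_le_card (fun x _ => hall x : (univ : Finset (Fin n)) ⊆ _)).trans
      Finset.card_le_two
    simp at this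
    omega
  have hxx₀ : x ≠ x₀ := fun h' => hx (by simp [h'])
  have hxg : g y ≠ x := fun h' => hx (by simp [h'])
  have hya : y ≠ a := fun h' => ha (h' ▸ hy)
  have happ : ∀ y x, c x - (∑ z, c z) / d * ambiguousGame S g d y x = H y x := fun y x =>
    congrFun (congrFun hc y) x
  have h1 := happ y x₀
  have h2 := happ y x
  have h3 := happ a x₀
  have h4 := happ a x
  simp only [ambiguousGame, hy, hgy, hxg, ha, H, hya, hxx₀, if_true, if_false] at h1 h2 h3 h4
  linarith

/-- A section of the guessing map: a choice of one guessing row for every input. -/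
def IsGuessSection (S : Finset (Fin n')) (g : Fin n' → Fin n) (s : Fin n → Fin n') : Prop :=
  ∀ t, s t ∈ S ∧ g (s t) = t

theorem IsGuessSection.update {s : Fin n → Fin n'} (hs : IsGuessSection S g s) {y : Fin n'}
    (hy : y ∈ S) : IsGuessSection S g (Function.update s (g y) y) := by
  intro t
  by_cases h : t = g y
  · subst h; simp [hy]
  · simpa [h] using hs t

theorem card_image_guess_le {s : Fin n → Fin n'} {T : Finset (Fin n)} (hT : T.card = d)
    {r : Fin n → Fin n} (hr : ∀ x, r x ∈ T) :
    (univ.image fun x => if x ∈ T then s x else s (r x)).card ≤ d := by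
  rw [← hT]
  refine (Finset.card_le_card ?_).trans (Finset.card_image_le (s := T) (f := s))
  intro y hy
  obtain ⟨x, -, rfl⟩ := Finset.mem_image.1 hy
  split_ifs with h
  · exact Finset.mem_image_of_mem s h
  · exact Finset.mem_image_of_mem s (hr x)

theorem sum_guess_eq {s : Fin n → Fin n'} (hs : IsGuessSection S g s) {T : Finset (Fin n)}
    (hT : T.card = d) {r : Fin n → Fin n} (hr : ∀ x, r x ∈ T) :
    ∑ x, ambiguousGame S g d (if x ∈ T then s x else s (r x)) x = d := by
  have h : ∀ x, ambiguousGame S g d (if x ∈ T then s x else s (r x)) x =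
      if x ∈ T then 1 else 0 := by
    intro x
    by_cases hx : x ∈ T
    · simp [ambiguousGame, hx, hs x]
    · have : r x ≠ x := fun h' => hx (h' ▸ hr x)
      simp [ambiguousGame, hx, hs (r x), this]
  rw [Finset.sum_congr rfl fun x _ => h x]
  simp [hT]

theorem card_image_guess_ambiguous_le {s : Fin n → Fin n'} {T : Finset (Fin n)}
    (hT : T.card + 1 = d) (a : Fin n') :
    (univ.image fun x => if x ∈ T then s x else a).card ≤ d := by
  have hsub : (univ.image fun x => if x ∈ T then s x else a) ⊆ insert a (T.image s) := by
    intro y hy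
    obtain ⟨x, -, rfl⟩ := Finset.mem_image.1 hy
    split_ifs with h
    · exact Finset.mem_insert_of_mem (Finset.mem_image_of_mem s h)
    · exact Finset.mem_insert_self _ _
  have h1 := Finset.card_le_card hsub
  have h2 := Finset.card_insert_le a (T.image s)
  have h3 := Finset.card_image_le (s := T) (f := s)
  omega

theorem sum_guess_ambiguous_eq (hdn : d < n) {s : Fin n → Fin n'} (hs : IsGuessSection S g s)
    {T : Finset (Fin n)} (hT : T.card + 1 = d) {a : Fin n'} (ha : a ∉ S) :
    ∑ x, ambiguousGame S g d (if x ∈ T then s x else a) x = d := by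
  have h : ∀ x, ambiguousGame S g d (if x ∈ T then s x else a) x =
      if x ∈ T then 1 else 1 / ((n : ℝ) - d + 1) := by
    intro x
    by_cases hx : x ∈ T
    · simp [ambiguousGame, hx, hs x]
    · simp [ambiguousGame, hx, ha]
  have hdn' : (d : ℝ) + 1 ≤ n := by exact_mod_cast hdn
  have hm : (n : ℝ) - d + 1 ≠ 0 := by linarith
  have hT' : (T.card : ℝ) + 1 = d := by exact_mod_cast hT
  have hTc : ((univ \ T).card : ℝ) = n - d + 1 := by
    have := Finset.card_sdiff_add_card_eq_card (Finset.subset_univ T)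
    rw [Finset.card_univ, Fintype.card_fin] at this
    have h' : ((univ \ T).card : ℝ) + T.card = n := by exact_mod_cast this
    linarith
  rw [Finset.sum_congr rfl fun x _ => h x, ← Finset.sum_sdiff (Finset.subset_univ T),
    Finset.sum_congr rfl fun x hx => if_neg (Finset.mem_sdiff.1 hx).2,
    Finset.sum_congr rfl fun x hx => if_pos hx, Finset.sum_const, Finset.sum_const,
    nsmul_eq_mul, nsmul_eq_mul, hTc]
  field_simp
  linarith

variable {H : Matrix (Fin n') (Fin n) ℝ}

theorem apply_eq_of_wrong_guess_of_ne (hd : 1 < d) (hdn : d < n) {s : Fin n → Fin n'}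
    (hs : IsGuessSection S g s)
    (hH : H ∈ vanishingFunctionals (saturatingVertices d (ambiguousGame S g d) (d : ℝ)))
    {x : Fin n} {y y' : Fin n'} (hy : y ∈ S) (hy' : y' ∈ S) (hyx : g y ≠ x) (hy'x : g y' ≠ x)
    (hne : g y ≠ g y') : H y x = H y' x := by
  rw [mem_vanishingFunctionals_saturatingVertices] at hH
  obtain ⟨T, hsub, hxT, hT⟩ := Finset.exists_subsuperset_card_eq
    (s := {g y, g y'}) (t := univ.erase x) (n := d)
    (by intro z hz; simp at hz ⊢; rintro rfl; rcases hz with h | h <;> simp_all)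
    (Finset.card_le_two.trans hd) (by simp; omega)
  have hyT : g y ∈ T := hsub (by simp)
  have hy'T : g y' ∈ T := hsub (by simp)
  replace hxT : x ∉ T := fun h => by simpa using hxT h
  have hs' := (hs.update hy).update hy'
  set s' := Function.update (Function.update s (g y) y) (g y') y'
  have hsy : s' (g y) = y := by simp [s', hne]
  have hsy' : s' (g y') = y' := by simp [s']
  have key : ∀ r : Fin n → Fin n, (∀ z, r z ∈ T) →
      ∑ z, H (if z ∈ T then s' z else s' (r z)) z = 0 := fun r hr =>
    hH _ (card_image_guess_le hT hr) (sum_guess_eq hs' hT hr)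
  have h1 := key (fun _ => g y) fun _ => hyT
  have h2 := key (fun z => if z = x then g y' else g y) fun z => by
    split_ifs <;> assumption
  rw [← Finset.add_sum_erase _ _ (Finset.mem_univ x)] at h1 h2
  rw [Finset.sum_congr rfl (g := fun z => H (if z ∈ T then s' z else s' (g y)) z)
    fun z hz => by simp [Finset.ne_of_mem_erase hz]] at h2
  simp only [hxT, if_true, if_false, hsy, hsy'] at h1 h2
  linarith

theorem apply_eq_of_wrong_guess (hd : 1 < d) (hdn : d < n) {s : Fin n → Fin n'}
    (hs : IsGuessSection S g s)
    (hH : H ∈ vanishingFunctionals (saturatingVertices d (ambiguousGame S g d) (d : ℝ)))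
    {x : Fin n} {y y' : Fin n'} (hy : y ∈ S) (hy' : y' ∈ S) (hyx : g y ≠ x)
    (hy'x : g y' ≠ x) : H y x = H y' x := by
  by_cases hne : g y = g y'
  · obtain ⟨t, ht⟩ : ∃ t, t ∉ ({x, g y} : Finset (Fin n)) := by
      by_contra! hall
      have := (Finset.card_le_card (fun x _ => hall x : (univ : Finset (Fin n)) ⊆ _)).trans
        Finset.card_le_two
      simp at this
      omega
    simp only [Finset.mem_insert, Finset.mem_singleton, not_or] at ht
    obtain ⟨htS, htg⟩ := hs t
    have htx : g (s t) ≠ x := htg.trans_ne ht.1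
    rw [apply_eq_of_wrong_guess_of_ne hd hdn hs hH hy htS hyx htx (by rw [htg]; exact Ne.symm ht.2),
      apply_eq_of_wrong_guess_of_ne hd hdn hs hH hy' htS hy'x htx
        (by rw [htg, ← hne]; exact Ne.symm ht.2)]
  · exact apply_eq_of_wrong_guess_of_ne hd hdn hs hH hy hy' hyx hy'x hne

theorem vanishingFunctionals_le_range (hd : 1 < d) (hdn : d < n)
    (hg : ∀ x, ∃ y ∈ S, g y = x) :
    vanishingFunctionals (saturatingVertices d (ambiguousGame S g d) (d : ℝ)) ≤
      LinearMap.range (trivialFunctionals (ambiguousGame S g d) (d : ℝ)) := by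
  intro H hH
  choose s hsS hsg using hg
  have hs : IsGuessSection S g s := fun t => ⟨hsS t, hsg t⟩
  have hd0 : (d : ℝ) ≠ 0 := by positivity
  have hdn' : (d : ℝ) + 1 ≤ n := by exact_mod_cast hdn
  have : Nontrivial (Fin n) := Fin.nontrivial_iff_two_le.2 (by omega)
  choose w hw using fun x : Fin n => exists_ne x
  set c : Fin n → ℝ := fun x => H (s (w x)) x
  have hwrong : ∀ y ∈ S, ∀ x, g y ≠ x → H y x = c x := fun y hy x hyx =>
    apply_eq_of_wrong_guess hd hdn hs hH hy (hsS _) hyx (by rw [hsg]; exact hw x)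
  have hvan := mem_vanishingFunctionals_saturatingVertices.1 hH
  have hsum : ∀ s, IsGuessSection S g s → ∀ T : Finset (Fin n), T.card = d →
      ∑ t ∈ T, (H (s t) t - c t) = -∑ x, c x := by
    intro s hs T hT
    obtain ⟨t₀, ht₀⟩ : T.Nonempty := Finset.card_pos.1 (by omega)
    have h := hvan _ (card_image_guess_le (s := s) hT fun _ => ht₀)
      (sum_guess_eq hs hT fun _ => ht₀)
    have hterm : ∀ x, H (if x ∈ T then s x else s t₀) x =
        (if x ∈ T then H (s x) x - c x else 0) + c x := by
      intro x
      split_ifs with hx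
      · ring
      · rw [hwrong _ (hs t₀).1, zero_add]
        rw [(hs t₀).2]
        rintro rfl
        exact hx ht₀
    rw [Finset.sum_congr rfl fun x _ => hterm x, Finset.sum_add_distrib,
      Finset.sum_ite_mem, Finset.univ_inter] at h
    linarith
  have hright : ∀ y ∈ S, H y (g y) = c (g y) - (∑ x, c x) / d := by
    intro y hy
    have h := eq_of_forall_sum_card_eq (by omega) hdn (hsum _ (hs.update hy)) (g y)
    simp only [Function.update_self] at h
    field_simp
    linarith
  have hambiguous : ∀ a ∉ S, ∀ x,
      H a x = c x - (∑ x, c x) / d * (1 / ((n : ℝ) - d + 1)) := by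
    intro a ha x
    have hU : ∀ U : Finset (Fin n), U.card = n - d + 1 →
        ∑ t ∈ U, (H a t - c t) = -(∑ x, c x) / d := by
      intro U hU
      have hT : (univ \ U).card + 1 = d := by
        have := Finset.card_sdiff_add_card_eq_card (Finset.subset_univ U)
        rw [Finset.card_univ, Fintype.card_fin] at this
        omega
      have h := hvan _ (card_image_guess_ambiguous_le (s := s) hT a)
        (sum_guess_ambiguous_eq hdn hs hT ha)
      have hterm : ∀ x, H (if x ∈ univ \ U then s x else a) x =
          (if x ∈ univ \ U then -(∑ x, c x) / d else 0) +
            (if x ∈ U then H a x - c x else 0) + c x := by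
        intro x
        by_cases hx : x ∈ U
        · simp [hx]
        · have := hright (s x) (hsS x)
          rw [hsg] at this
          simp [hx, this]
          ring
      have hT' : ((univ \ U).card : ℝ) + 1 = d := by exact_mod_cast hT
      rw [Finset.sum_congr rfl fun x _ => hterm x, Finset.sum_add_distrib,
        Finset.sum_add_distrib, Finset.sum_ite_mem, Finset.sum_ite_mem, Finset.univ_inter,
        Finset.univ_inter, Finset.sum_const, nsmul_eq_mul, eq_sub_of_add_eq hT'] at h
      have h' : (d : ℝ) * (-(∑ x, c x) / d) = -∑ x, c x := by field_simp
      linarith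
    have h := eq_of_forall_sum_card_eq (by omega) (by omega) hU x
    push_cast [Nat.cast_sub hdn.le] at h
    have hm : (n : ℝ) - d + 1 ≠ 0 := by linarith
    field_simp at h ⊢
    linarith
  refine ⟨c, ?_⟩
  ext y x
  rw [trivialFunctionals_apply]
  by_cases hy : y ∈ S
  · by_cases hyx : g y = x
    · subst hyx
      simp [ambiguousGame, hy, hright y hy]
    · simp [ambiguousGame, hy, hyx, hwrong y hy x hyx]
  · simp [ambiguousGame, hy, hambiguous y hy x]

theorem isTightBell_ambiguousGame_iff (hd : 1 < d) (hdn : d < n) (hS : S.Nonempty)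
    (hSc : ∃ a, a ∉ S) :
    IsTightBell n n' d (ambiguousGame S g d) (d : ℝ) ↔ ∀ x, ∃ y ∈ S, g y = x := by
  obtain ⟨a, ha⟩ := hSc
  rw [isTightBell_iff a.pos (by positivity)]
  constructor
  · rintro ⟨-, h⟩
    exact exists_guess_of_finrank_le hd hdn hS ha h
  · intro hg
    refine ⟨fun V hV => ?_, ?_⟩
    · obtain ⟨f, rfl, hf⟩ := hV.exists_eq_deterministicChannel
      rw [bip_deterministicChannel]
      exact sum_ambiguousGame_le hdn hf
    · exact (Submodule.finrank_mono (vanishingFunctionals_le_range hd hdn hg)).trans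
        ((LinearMap.finrank_range_le _).trans (by simp))

theorem rank_submatrix_ambiguousGame_eq_iff :
    ((ambiguousGame S g d).submatrix (fun y : {y : Fin n' // y ∈ S} => (y : Fin n'))
      id).rank = n ↔ ∀ x, ∃ y ∈ S, g y = x := by
  set A := (ambiguousGame S g d).submatrix (fun y : {y : Fin n' // y ∈ S} => (y : Fin n')) id
  have hA : ∀ v y, A.mulVec v y = v (g y) := by
    intro v y
    simp [A, Matrix.mulVec, dotProduct, ambiguousGame]
  have hrank : A.rank = n ↔ LinearMap.ker A.mulVecLin = ⊥ := by
    have h := LinearMap.finrank_range_add_finrank_ker A.mulVecLin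
    rw [Module.finrank_fin_fun] at h
    rw [← Submodule.finrank_eq_zero (R := ℝ), Matrix.rank]
    omega
  rw [hrank, LinearMap.ker_eq_bot']
  constructor
  · intro h x
    by_contra! hx
    have h0 := h (Pi.single x 1) (by
      ext y
      rw [Matrix.mulVecLin_apply, hA]
      simp [hx y y.2])
    simpa using congrFun h0 x
  · intro hg v hv
    ext x
    obtain ⟨y, hy, rfl⟩ := hg x
    rw [← hA v ⟨y, hy⟩, ← Matrix.mulVecLin_apply, hv]
    rfl

end Game

/-- Proposition 2(ii) (rank form): for `n' > k ≥ n > d > 1`, an ambiguous guessing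
game matrix `G` with `k` guessing rows (indexed by `S`) and `n' - k` ambiguous rows
gives a tight Bell inequality `(G, d)` of `C_d^{n → n'}` iff the submatrix of
guessing rows has rank `n`. -/
theorem ambiguousGame_tightBell_iff_rank (n n' k d : ℕ)
    (hd : 1 < d) (hdn : d < n) (hnk : n ≤ k) (hkn' : k < n')
    (G : Matrix (Fin n') (Fin n) ℝ) (S : Finset (Fin n')) (hS : S.card = k)
    (hguess : ∀ y ∈ S, ∃ x₀, G y x₀ = 1 ∧ ∀ x, x ≠ x₀ → G y x = 0)
    (hamb : ∀ y ∉ S, ∀ x, G y x = 1 / ((n : ℝ) - (d : ℝ) + 1)) :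
    IsTightBell n n' d G (d : ℝ) ↔
      (G.submatrix (fun y : {y : Fin n' // y ∈ S} => (y : Fin n')) id).rank = n := by
  have hex : ∀ y, ∃ x₀ : Fin n, y ∈ S → G y x₀ = 1 ∧ ∀ x, x ≠ x₀ → G y x = 0 := by
    intro y
    by_cases hy : y ∈ S
    · obtain ⟨x₀, h⟩ := hguess y hy
      exact ⟨x₀, fun _ => h⟩
    · exact ⟨⟨0, by omega⟩, fun h => absurd h hy⟩
  choose g hg using hex
  obtain rfl : G = ambiguousGame S g d := by
    ext y x
    by_cases hy : y ∈ S
    · by_cases hx : g y = x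
      · subst hx
        simp [ambiguousGame, hy, (hg y hy).1]
      · simp [ambiguousGame, hy, hx, (hg y hy).2 x (Ne.symm hx)]
    · simp [ambiguousGame, hy, hamb y hy x]
  have hSc : ∃ a, a ∉ S := by
    by_contra! h
    have : S = univ := Finset.eq_univ_iff_forall.2 h
    rw [this, Finset.card_univ, Fintype.card_fin] at hS
    omega
  rw [isTightBell_ambiguousGame_iff hd hdn (Finset.card_pos.1 (by omega)) hSc,
    rank_submatrix_ambiguousGame_eq_iff]
end
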